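/- Let (G,G⁺,u) and (H,H⁺,w) be simple dimension groups with distinguished order units such that (H,H⁺,w) admits a unique trace. Suppose there exists an order embedding i : H → G, i.e., an injective group homomorphism with i(h) ∈ G⁺ if and only if h ∈ H⁺, and i(w) = u, such that the quotient group G/i(H) is torsion free. Then 𝓔(H,H⁺,w) ⊆ 𝓔(G,G⁺,u). -/

import Mathlib

/-- A simple dimension group with distinguished order unit, given by an abelian group `G`,
a positive cone `P` and an order unit `u`. -/
structure IsSimpleDimensionGroup (G : Type*) [AddCommGroup G] (P : Set G) (u : G) : Prop where
  countable : Countable G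
  pos_sub : ∀ g : G, ∃ a ∈ P, ∃ b ∈ P, g = a - b
  pos_antisymm : ∀ g : G, g ∈ P → -g ∈ P → g = 0
  pos_add : ∀ a ∈ P, ∀ b ∈ P, a + b ∈ P
  unperforated : ∀ (n : ℕ) (a : G), 1 ≤ n → n • a ∈ P → a ∈ P
  riesz : ∀ a₁ a₂ b₁ b₂ : G,
    b₁ - a₁ ∈ P → b₂ - a₁ ∈ P → b₁ - a₂ ∈ P → b₂ - a₂ ∈ P →
    ∃ c : G, c - a₁ ∈ P ∧ c - a₂ ∈ P ∧ b₁ - c ∈ P ∧ b₂ - c ∈ P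
  simple : ∀ g ∈ P, g ≠ 0 → ∀ a : G, ∃ n : ℕ, n • g - a ∈ P
  unit_pos : u ∈ P
  unit_order : ∀ a : G, ∃ n : ℕ, n • u - a ∈ P

/-- A trace on `(G, P, u)`: a nonnegative group homomorphism to `ℝ` normalized at `u`. -/
def IsTrace {G : Type*} [AddCommGroup G] (P : Set G) (u : G) (τ : G →+ ℝ) : Prop :=
  (∀ g ∈ P, 0 ≤ τ g) ∧ τ u = 1

/-- A minimal Cantor system: a homeomorphism of a Cantor space all of whose orbits are
dense. -/
structure MinimalCantorSystem where
  /-- the phase space -/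
  X : Type
  [ts : TopologicalSpace X]
  [cs : CompactSpace X]
  [ms : TopologicalSpace.MetrizableSpace X]
  [tds : TotallyDisconnectedSpace X]
  [ne : Nonempty X]
  noIsolated : ∀ x : X, ¬IsOpen ({x} : Set X)
  /-- the homeomorphism -/
  T : X ≃ₜ X
  minimal : ∀ x : X, Dense (Set.range fun n : ℤ => (T.toEquiv ^ n) x)

attribute [instance] MinimalCantorSystem.ts MinimalCantorSystem.cs MinimalCantorSystem.ms
  MinimalCantorSystem.tds MinimalCantorSystem.ne

/-- The coboundary homomorphism `g ↦ g∘T − g` on `C(X,ℤ)`. -/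
def cobMap (M : MinimalCantorSystem) : C(M.X, ℤ) →+ C(M.X, ℤ) where
  toFun g := g.comp ⟨⇑M.T, M.T.continuous⟩ - g
  map_zero' := by ext x; simp
  map_add' g₁ g₂ := by ext x; simp; ring

/-- The group `K⁰(X,T) = C(X,ℤ)/∂`. -/
def K0 (M : MinimalCantorSystem) : Type := C(M.X, ℤ) ⧸ (cobMap M).range

noncomputable instance (M : MinimalCantorSystem) : AddCommGroup (K0 M) :=
  QuotientAddGroup.Quotient.addCommGroup (cobMap M).range

/-- The positive cone of `K⁰(X,T)`: classes of nonnegative functions. -/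
def posCone (M : MinimalCantorSystem) : Set (K0 M) :=
  (QuotientAddGroup.mk (s := (cobMap M).range)) '' {f : C(M.X, ℤ) | ∀ x : M.X, 0 ≤ f x}

/-- The order unit of `K⁰(X,T)`: the class of the constant function `1`. -/
def unitClass (M : MinimalCantorSystem) : K0 M :=
  QuotientAddGroup.mk (s := (cobMap M).range) 1

/-- The set `E(X,T)` of additive continuous eigenvalues. -/
def eigSet (M : MinimalCantorSystem) : Set ℝ :=
  {α : ℝ | ∃ f : C(M.X, ℂ), f ≠ 0 ∧
    ∀ x : M.X, f (M.T x) = Complex.exp (2 * Real.pi * Complex.I * α) * f x}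

/-- Two subsets of `ℝ` (which in practice are subgroups) are isomorphic as groups:
there is a bijection between them preserving addition in both directions. -/
def SetAddIso (A B : Set ℝ) : Prop :=
  ∃ e : A ≃ B,
    (∀ x y z : A, (x : ℝ) + (y : ℝ) = (z : ℝ) → (e x : ℝ) + (e y : ℝ) = (e z : ℝ)) ∧
    (∀ x y z : B, (x : ℝ) + (y : ℝ) = (z : ℝ) →
      (e.symm x : ℝ) + (e.symm y : ℝ) = (e.symm z : ℝ))

/-- `Γ ∈ 𝓔(G,P,u)`: there is a minimal Cantor system `(X,T)` such that `K⁰(X,T)` is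
isomorphic to `(G,P,u)` as ordered groups with distinguished order unit, and `E(X,T)` is
isomorphic to `Γ` as groups. -/
def MemE {G : Type} [AddCommGroup G] (P : Set G) (u : G) (Γ : AddSubgroup ℝ) : Prop :=
  ∃ M : MinimalCantorSystem,
    (∃ φ : K0 M ≃+ G, ⇑φ '' posCone M = P ∧ φ (unitClass M) = u) ∧
    SetAddIso (eigSet M) (Γ : Set ℝ)

namespace SimpleDim
open Finset

section Algebra
variable {G : Type} [AddCommGroup G] {P : Set G} {u : G}

lemma sum_mem (hG : IsSimpleDimensionGroup G P u) (h0 : (0 : G) ∈ P) {ι : Type*}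
    (s : Finset ι) (a : ι → G) (ha : ∀ i ∈ s, a i ∈ P) : ∑ i ∈ s, a i ∈ P := by
  classical
  induction s using Finset.induction_on with
  | empty => simpa using h0
  | insert i s hi ih =>
    rw [Finset.sum_insert hi]
    exact hG.pos_add _ (ha i (by simp)) _ (ih fun j hj => ha j (by simp [hj]))

lemma nsmul_mem' (hG : IsSimpleDimensionGroup G P u) (h0 : (0 : G) ∈ P) (n : ℕ) {a : G}
    (ha : a ∈ P) : n • a ∈ P := by
  have := sum_mem hG h0 (Finset.range n) (fun _ => a) (fun _ _ => ha)
  simpa using this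

lemma zsmul_mem' (hG : IsSimpleDimensionGroup G P u) (h0 : (0 : G) ∈ P) {n : ℤ} (hn : 0 ≤ n)
    {a : G} (ha : a ∈ P) : n • a ∈ P := by
  lift n to ℕ using hn
  simpa using nsmul_mem' hG h0 n ha

/-- Riesz decomposition below a sum of two positive elements. -/
lemma riesz_decomp (hG : IsSimpleDimensionGroup G P u) {x a b : G}
    (hx : x ∈ P) (ha : a ∈ P) (hb : b ∈ P) (h : a + b - x ∈ P) :
    ∃ y ∈ P, x - y ∈ P ∧ a - y ∈ P ∧ b - (x - y) ∈ P := by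
  obtain ⟨c, h1, h2, h3, h4⟩ := hG.riesz 0 (x - b) x a (by simpa using hx) (by simpa using ha)
    (by simpa using hb) (by rw [show a - (x - b) = a + b - x by abel]; exact h)
  exact ⟨c, by simpa using h1, h3, h4, by rw [show b - (x - c) = c - (x - b) by abel]; exact h2⟩

lemma riesz_decomp_finset (hG : IsSimpleDimensionGroup G P u) (h0 : (0 : G) ∈ P) {ι : Type*}
    (s : Finset ι) (a : ι → G) (ha : ∀ i ∈ s, a i ∈ P) (x : G) (hx : x ∈ P)
    (h : ∑ i ∈ s, a i - x ∈ P) :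
    ∃ y : ι → G, (∀ i ∈ s, y i ∈ P ∧ a i - y i ∈ P) ∧ x = ∑ i ∈ s, y i := by
  classical
  induction s using Finset.induction_on generalizing x with
  | empty =>
    refine ⟨fun _ => 0, by simp, ?_⟩
    simp only [Finset.sum_empty, zero_sub] at h ⊢
    exact hG.pos_antisymm x hx h
  | insert i s hi ih =>
    rw [Finset.sum_insert hi] at h
    obtain ⟨y, hy, hxy, hay, hb⟩ := riesz_decomp hG hx (ha i (by simp))
      (sum_mem hG h0 s a fun j hj => ha j (by simp [hj])) h
    obtain ⟨z, hz, hzs⟩ := ih (fun j hj => ha j (by simp [hj])) (x - y) hxy hb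
    refine ⟨Function.update z i y, ?_, ?_⟩
    · intro j hj
      by_cases hji : j = i
      · subst hji; simp [hy, hay]
      · rw [Function.update_of_ne hji]
        exact hz j (by simpa [hji] using hj)
    · rw [Finset.sum_insert hi, Function.update_self]
      rw [Finset.sum_congr rfl (g := z)]
      · rw [← hzs]; abel
      · intro j hj
        rw [Function.update_of_ne]
        rintro rfl; exact hi hj

/-- One step of Shen's algorithm: a coefficient of maximal modulus is traded for strictly
smaller ones. -/
lemma shen_step (hG : IsSimpleDimensionGroup G P u) (h0 : (0 : G) ∈ P) {ι : Type} [Fintype ι]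
    [DecidableEq ι] (x : ι → G) (hx : ∀ i, x i ∈ P) (c : ι → ℤ) (hc : ∑ i, c i • x i = 0)
    (M : ℕ) (hM : 0 < M) (hcM : ∀ i, |c i| ≤ M) (i₀ : ι) (hi₀ : c i₀ = M) :
    ∃ (x' : ι ⊕ ι → G) (c' : ι ⊕ ι → ℤ) (R : ι → ι ⊕ ι → ℕ), (∀ j, x' j ∈ P) ∧
      (∀ i, x i = ∑ j, R i j • x' j) ∧ (∀ j, ∑ i, c i * R i j = c' j) ∧
      (∀ j, |c' j| ≤ M) ∧
      #{j | |c' j| = M} < #{i | |c i| = M} := by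
  set N : Finset ι := {i | c i < 0} with hN
  have hi₀N : i₀ ∉ N := by simp [hN, hi₀]
  have key : ∑ i ∈ N, x i - x i₀ ∈ P := by
    apply hG.unperforated M _ hM
    have : M • (∑ i ∈ N, x i - x i₀) =
        ∑ i ∈ N, ((M : ℤ) + c i) • x i + ∑ i ∈ Nᶜ.erase i₀, c i • x i := by
      have e : ∑ i, c i • x i = ∑ i ∈ N, c i • x i + (c i₀ • x i₀ + ∑ i ∈ Nᶜ.erase i₀, c i • x i) := by
        rw [Finset.add_sum_erase _ (fun i => c i • x i) (by simpa using hi₀N), Finset.sum_add_sum_compl]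
      rw [hc, hi₀] at e
      simp only [add_smul, Finset.sum_add_distrib, ← Finset.smul_sum, natCast_zsmul, smul_sub] at e ⊢
      rw [← sub_eq_zero] at e
      rw [← sub_eq_zero]
      refine Eq.trans ?_ e
      abel
    rw [this]
    refine hG.pos_add _ (sum_mem hG h0 _ _ ?_) _ (sum_mem hG h0 _ _ ?_)
    · intro i _
      have := abs_le.1 (hcM i)
      exact zsmul_mem' hG h0 (by linarith) (hx i)
    · intro i hi
      simp [hN] at hi
      exact zsmul_mem' hG h0 (by linarith) (hx i)
  obtain ⟨y, hy, hys⟩ := riesz_decomp_finset hG h0 N x (fun i _ => hx i) (x i₀) (hx i₀) key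
  let x' : ι ⊕ ι → G := Sum.elim
    (fun i => if i = i₀ then 0 else if i ∈ N then x i - y i else x i)
    (fun i => if i ∈ N then y i else 0)
  let c' : ι ⊕ ι → ℤ := Sum.elim (fun i => if i = i₀ then 0 else c i)
    (fun i => if i ∈ N then c i + M else 0)
  let R : ι → ι ⊕ ι → ℕ := fun i => Sum.elim (fun j => if i = j ∧ j ≠ i₀ then 1 else 0)
    (fun j => if j ∈ N ∧ (i = j ∨ i = i₀) then 1 else 0)
  refine ⟨x', c', R, ?_, ?_, ?_, ?_, ?_⟩
  · rintro (i | i)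
    · simp only [x', Sum.elim_inl]
      split_ifs with h1 h2
      · exact h0
      · exact (hy i h2).2
      · exact hx i
    · simp only [x', Sum.elim_inr]
      split_ifs with h1
      · exact (hy i h1).1
      · exact h0
  · intro i
    rw [Fintype.sum_sum_type]
    simp only [R, x', Sum.elim_inl, Sum.elim_inr]
    by_cases hi : i = i₀
    · subst hi
      rw [Finset.sum_eq_zero, zero_add]
      · rw [hys, ← Finset.sum_filter_add_sum_filter_not univ (· ∈ N)]
        rw [Finset.sum_eq_zero (s := {j | j ∉ N}), add_zero]
        · rw [Finset.filter_mem_eq_inter, Finset.univ_inter]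
          exact Finset.sum_congr rfl fun j hj => by simp [hj]
        · intro j hj
          simp at hj; simp [hj]
      · intro j _
        by_cases h : j = i
        · simp [h]
        · simp [h, Ne.symm h]
    · rw [Finset.sum_eq_single i, Finset.sum_eq_single i]
      · by_cases h : i ∈ N <;> simp [h, hi]
      · intro j _ hj; simp [hj.symm, hi]
      · simp
      · intro j _ hj; simp [hj.symm]
      · simp
  · rintro (j | j)
    · simp only [R, c', Sum.elim_inl]
      rw [Finset.sum_eq_single j]
      · by_cases h : j = i₀ <;> simp [h]
      · intro i _ hi; simp [hi]
      · simp
    · simp only [R, c', Sum.elim_inr]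
      by_cases h : j ∈ N
      · have hj : j ≠ i₀ := fun e => hi₀N (e ▸ h)
        rw [← Finset.add_sum_erase _ _ (Finset.mem_univ j),
          ← Finset.add_sum_erase (Finset.univ.erase j) _ (a := i₀) (by simp [hj.symm]),
          Finset.sum_eq_zero]
        · simp [h, hi₀]
        · intro i hi
          simp at hi
          simp [hi.1, hi.2]
      · simp [h]
  · rintro (j | j)
    · simp only [c', Sum.elim_inl]
      split_ifs
      · simp
      · exact hcM j
    · simp only [c', Sum.elim_inr]
      split_ifs with h
      · have h1 := abs_le.1 (hcM j)
        simp [hN] at h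
        rw [abs_le]; constructor <;> linarith
      · simp
  · have hsub : ({j | |c' j| = (M : ℤ)} : Finset (ι ⊕ ι)) ⊆
        (({i | |c i| = (M : ℤ)} : Finset ι).erase i₀).map ⟨Sum.inl, Sum.inl_injective⟩ := by
      rintro (j | j) hj
      · simp only [c', Finset.mem_filter, Finset.mem_univ, true_and, Sum.elim_inl] at hj
        split_ifs at hj with h
        · simp at hj; omega
        · simp [h, hj]
      · exfalso
        simp only [c', Finset.mem_filter, Finset.mem_univ, true_and, Sum.elim_inr] at hj
        split_ifs at hj with h
        · have h1 := abs_le.1 (hcM j)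
          simp [hN] at h
          rw [abs_of_nonneg (by linarith)] at hj
          linarith
        · simp at hj; omega
    refine lt_of_le_of_lt (Finset.card_le_card hsub) ?_
    rw [Finset.card_map]
    exact Finset.card_erase_lt_of_mem (by simp [hi₀])

/-- Shen's lemma: a relation between positive elements becomes trivial after writing these as
nonnegative combinations of suitable positive elements. -/
lemma shen (hG : IsSimpleDimensionGroup G P u) (h0 : (0 : G) ∈ P) {ι : Type} [Fintype ι]
    (x : ι → G) (hx : ∀ i, x i ∈ P) (c : ι → ℤ) (hc : ∑ i, c i • x i = 0) :
    ∃ (κ : Type) (_ : Fintype κ) (z : κ → G) (R : ι → κ → ℕ), (∀ j, z j ∈ P) ∧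
      (∀ i, x i = ∑ j, R i j • z j) ∧ ∀ j, ∑ i, c i * R i j = 0 := by
  obtain ⟨M, hM⟩ : ∃ M : ℕ, ∀ i, |c i| ≤ M :=
    ⟨∑ i, (c i).natAbs, fun i => by
      rw [Int.abs_eq_natAbs]
      exact_mod_cast Finset.single_le_sum (f := fun i => (c i).natAbs) (by simp) (mem_univ i)⟩
  classical
  induction M generalizing ι with
  | zero =>
    have hc0 : ∀ i, c i = 0 := fun i => by simpa using hM i
    refine ⟨ι, inferInstance, x, fun i j => if i = j then 1 else 0, hx, ?_, ?_⟩
    · intro i; simp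
    · intro j; simp [hc0]
  | succ M ihM =>
    obtain ⟨k, hk⟩ : ∃ k, #{i | |c i| = ((M + 1 : ℕ) : ℤ)} = k := ⟨_, rfl⟩
    induction k using Nat.strong_induction_on generalizing ι with
    | _ k ihk =>
      by_cases hex : ∃ i₀, |c i₀| = ((M + 1 : ℕ) : ℤ)
      · obtain ⟨i₀, hi₀⟩ := hex
        have main : ∃ (x' : ι ⊕ ι → G) (c' : ι ⊕ ι → ℤ) (R : ι → ι ⊕ ι → ℕ), (∀ j, x' j ∈ P) ∧
            (∀ i, x i = ∑ j, R i j • x' j) ∧ (∀ j, ∑ i, c i * R i j = c' j) ∧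
            (∀ j, |c' j| ≤ ((M + 1 : ℕ) : ℤ)) ∧
            #{j | |c' j| = ((M + 1 : ℕ) : ℤ)} < #{i | |c i| = ((M + 1 : ℕ) : ℤ)} := by
          rcases abs_choice (c i₀) with h | h
          · exact shen_step hG h0 x hx c hc (M + 1) (by omega) hM i₀ (by rw [← h, hi₀])
          · obtain ⟨x', c', R, h1, h2, h3, h4, h5⟩ := shen_step hG h0 x hx (fun i => - c i)
              (by simp [hc]) (M + 1) (by omega) (by simpa using hM) i₀ (by rw [← hi₀, h])
            refine ⟨x', fun j => - c' j, R, h1, h2, ?_, by simpa using h4, by simpa using h5⟩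
            intro j
            simp [← h3 j]
        obtain ⟨x', c', R, h1, h2, h3, h4, h5⟩ := main
        obtain ⟨κ, _, z, R', g1, g2, g3⟩ := ihk _ (hk ▸ h5) x' h1 c' (by
          rw [← hc]
          simp_rw [← h3, h2, Finset.smul_sum, Finset.sum_smul]
          rw [Finset.sum_comm]
          simp [mul_smul]) h4 rfl
        refine ⟨κ, inferInstance, z, fun i k => ∑ j, R i j * R' j k, g1, ?_, ?_⟩
        · intro i
          rw [h2 i]
          simp_rw [g2, Finset.smul_sum, Finset.sum_smul]
          rw [Finset.sum_comm]
          simp [mul_smul]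
        · intro k
          rw [← g3 k]
          simp_rw [← h3]
          push_cast
          simp_rw [Finset.mul_sum, Finset.sum_mul]
          rw [Finset.sum_comm]
          simp [mul_assoc]
      · push Not at hex
        refine ihM x hx c hc fun i => ?_
        have h1 := hM i
        have h2 := hex i
        push_cast at h1 h2 ⊢
        omega

lemma shen_family (hG : IsSimpleDimensionGroup G P u) (h0 : (0 : G) ∈ P) {ι : Type} [Fintype ι]
    {ρ : Type*} (s : Finset ρ)
    (x : ι → G) (hx : ∀ i, x i ∈ P) (c : ρ → ι → ℤ) (hc : ∀ r ∈ s, ∑ i, c r i • x i = 0) :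
    ∃ (κ : Type) (_ : Fintype κ) (z : κ → G) (R : ι → κ → ℕ), (∀ j, z j ∈ P) ∧
      (∀ i, x i = ∑ j, R i j • z j) ∧ ∀ r ∈ s, ∀ j, ∑ i, c r i * R i j = 0 := by
  classical
  induction s using Finset.induction_on with
  | empty =>
    exact ⟨ι, inferInstance, x, fun i j => if i = j then 1 else 0, hx, by simp, by simp⟩
  | insert r s hr ih =>
    obtain ⟨κ, _, z, R, h1, h2, h3⟩ := ih fun r hr => hc r (by simp [hr])
    obtain ⟨κ', _, z', R', g1, g2, g3⟩ := shen hG h0 z h1 (fun j => ∑ i, c r i * R i j) (by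
      rw [← hc r (by simp)]
      simp_rw [h2, Finset.smul_sum, Finset.sum_smul]
      rw [Finset.sum_comm]
      simp [mul_smul])
    refine ⟨κ', inferInstance, z', fun i k => ∑ j, R i j * R' j k, g1, ?_, ?_⟩
    · intro i
      rw [h2 i]
      simp_rw [g2, Finset.smul_sum, Finset.sum_smul]
      rw [Finset.sum_comm]
      simp [mul_smul]
    · intro r' hr' k
      have e : ∀ r', ∑ i, c r' i * ((∑ j, R i j * R' j k : ℕ) : ℤ)
          = ∑ j, (∑ i, c r' i * R i j) * R' j k := by
        intro r'
        push_cast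
        simp_rw [Finset.mul_sum, Finset.sum_mul]
        rw [Finset.sum_comm]
        simp [mul_assoc]
      rw [e]
      rcases Finset.mem_insert.1 hr' with rfl | h
      · exact g3 k
      · simp [h3 r' h]

/-- Rounding a weighted distribution of an integer. -/
lemma exists_round {I : Type*} [Fintype I] (ω : I → ℝ) (hω : ∑ i, ω i = 1) (t : ℤ) :
    ∃ f : I → ℤ, ∑ i, f i = t ∧ ∀ i, |(f i : ℝ) - ω i * t| ≤ 1 := by
  classical
  have h1 : ((∑ i, ⌊ω i * t⌋ : ℤ) : ℝ) ≤ t := by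
    push_cast
    calc ∑ i, (⌊ω i * t⌋ : ℝ) ≤ ∑ i, ω i * t := Finset.sum_le_sum fun i _ => Int.floor_le _
      _ = t := by rw [← Finset.sum_mul, hω, one_mul]
  have h2 : (t : ℝ) ≤ ((∑ i, ⌊ω i * t⌋ : ℤ) : ℝ) + Fintype.card I := by
    push_cast
    calc (t : ℝ) = ∑ i, ω i * t := by rw [← Finset.sum_mul, hω, one_mul]
      _ ≤ ∑ i, ((⌊ω i * t⌋ : ℝ) + 1) := Finset.sum_le_sum fun i _ => (Int.lt_floor_add_one _).le
      _ = _ := by simp [Finset.sum_add_distrib]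
  have h1' : (∑ i, ⌊ω i * t⌋ : ℤ) ≤ t := by exact_mod_cast h1
  have h2' : t ≤ (∑ i, ⌊ω i * t⌋ : ℤ) + Fintype.card I := by exact_mod_cast h2
  obtain ⟨r, hr⟩ := Int.eq_ofNat_of_zero_le (sub_nonneg.2 h1')
  obtain ⟨s, -, hs⟩ := Finset.exists_subset_card_eq (s := (Finset.univ : Finset I)) (n := r)
    (by rw [Finset.card_univ]; omega)
  refine ⟨fun i => ⌊ω i * t⌋ + if i ∈ s then 1 else 0, ?_, ?_⟩
  · rw [Finset.sum_add_distrib]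
    simp [hs]; omega
  · intro i
    have a1 := Int.floor_le (ω i * t)
    have a2 := Int.lt_floor_add_one (ω i * t)
    rw [abs_le]
    by_cases h : i ∈ s <;> simp only [h, if_true, if_false] <;> push_cast <;>
      constructor <;> linarith

end Algebra

section Algebra
variable {G : Type} [AddCommGroup G] {P : Set G} {u : G}

lemma shen_family_ne (hG : IsSimpleDimensionGroup G P u) (h0 : (0 : G) ∈ P) {ι : Type} [Fintype ι]
    {ρ : Type*} [Fintype ρ]
    (x : ι → G) (hx : ∀ i, x i ∈ P) (c : ρ → ι → ℤ) (hc : ∀ r, ∑ i, c r i • x i = 0) :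
    ∃ (κ : Type) (_ : Fintype κ) (z : κ → G) (R : ι → κ → ℕ), (∀ j, z j ∈ P) ∧ (∀ j, z j ≠ 0) ∧
      (∀ i, x i = ∑ j, R i j • z j) ∧ ∀ r j, ∑ i, c r i * R i j = 0 := by
  classical
  obtain ⟨κ, _, z, R, h1, h2, h3⟩ := shen_family hG h0 Finset.univ x hx c fun r _ => hc r
  refine ⟨{j : κ // z j ≠ 0}, inferInstance, fun j => z j, fun i j => R i j, fun j => h1 j,
    fun j => j.2, ?_, fun r j => h3 r (mem_univ _) j⟩
  intro i
  rw [h2 i, ← Finset.sum_subset (Finset.subset_univ ({j | z j ≠ 0} : Finset κ))]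
  · exact Finset.sum_subtype _ (by simp) _
  · intro j _ hj
    simp at hj
    simp [hj]

/-- Refinement of a family of positive elements over prescribed columns `v k` of heights `h k`. -/
lemma exists_refinement (hG : IsSimpleDimensionGroup G P u) (h0 : (0 : G) ∈ P) {S K : Type}
    [Fintype S] [Fintype K] [DecidableEq K] {p : ℕ}
    (v : K → G) (hv : ∀ k, v k ∈ P) (h : K → ℕ) (hh : ∀ k, 0 < h k) (hu : u = ∑ k, h k • v k)
    (f : Fin p → G) (hf : ∀ l, f l ∈ P)
    (g : S → G) (α : S → K → ℤ) (b : S → Fin p → ℤ)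
    (hg : ∀ s, g s = ∑ k, α s k • v k + ∑ l, b s l • f l)
    (q : ℕ) (hq : 0 < q) (hgq : ∀ s, q • g s - u ∈ P)
    (θ : S → ℝ) (hα : ∀ s k, |(α s k : ℝ) - θ s * h k| ≤ h k / (4 * q))
    (hbig : ∀ s k, ∑ l, |(b s l : ℝ)| + 2 ≤ h k / (2 * q)) :
    ∃ (m : ℕ) (base : Fin m → K) (g' : Fin m → G) (t : Fin m → Fin p → ℤ),
      (∀ j, g' j ∈ P ∧ g' j ≠ 0) ∧ (∀ k, v k = ∑ j, if base j = k then g' j else 0) ∧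
      (∀ l, f l = ∑ j, t j l • g' j) ∧ ∀ s j, 2 ≤ α s (base j) + ∑ l, b s l * t j l := by
  classical
  obtain ⟨N, hN⟩ : ∃ N : ℕ, ∀ l, N • u - f l ∈ P := by
    choose n hn using fun l => hG.unit_order (f l)
    refine ⟨∑ l, n l, fun l => ?_⟩
    rw [← Finset.add_sum_erase _ _ (mem_univ l), add_smul, add_sub_right_comm]
    exact hG.pos_add _ (hn l) _ (nsmul_mem' hG h0 _ hG.unit_pos)
  let x : K ⊕ Fin p ⊕ S ⊕ Fin p → G := Sum.elim v (Sum.elim f (Sum.elim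
    (fun s => q • g s - u) (fun l => N • u - f l)))
  let c : S ⊕ Fin p → K ⊕ Fin p ⊕ S ⊕ Fin p → ℤ := Sum.elim
    (fun s => Sum.elim (fun k => q * α s k - h k) (Sum.elim (fun l => q * b s l)
      (Sum.elim (fun s' => if s' = s then -1 else 0) (fun _ => 0))))
    (fun l => Sum.elim (fun k => N * h k) (Sum.elim (fun l' => if l' = l then -1 else 0)
      (Sum.elim (fun _ => 0) (fun l' => if l' = l then -1 else 0))))
  obtain ⟨J, _, z, R, hz, hz0, hx, hR⟩ := shen_family_ne hG h0 x (by
    rintro (k | l | s | l)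
    · exact hv k
    · exact hf l
    · exact hgq s
    · exact hN l) c (by
    rintro (s | l)
    · simp only [Fintype.sum_sum_type, c, x, Sum.elim_inl, Sum.elim_inr]
      simp only [hg, hu, sub_smul, mul_smul, Finset.sum_sub_distrib, ← Finset.smul_sum,
        natCast_zsmul, ite_smul, Finset.sum_ite_eq', Finset.mem_univ, if_true, zero_smul,
        Finset.sum_const_zero, smul_add]
      simp
      abel
    · simp only [Fintype.sum_sum_type, c, x, Sum.elim_inl, Sum.elim_inr]
      simp only [hu, mul_smul, ← Finset.smul_sum,
        natCast_zsmul, ite_smul, Finset.sum_ite_eq', Finset.mem_univ, if_true, zero_smul,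
        Finset.sum_const_zero]
      simp
      abel)
  set σ : K → J → ℕ := fun k j => R (.inl k) j with hσ
  set T : Fin p → J → ℕ := fun l j => R (.inr (.inl l)) j with hT
  have rel1 : ∀ s j, (∑ k, (h k : ℤ) * σ k j) ≤
      q * (∑ k, α s k * σ k j + ∑ l, b s l * T l j) := by
    intro s j
    have := hR (.inl s) j
    simp only [Fintype.sum_sum_type, c, Sum.elim_inl, Sum.elim_inr] at this
    simp only [sub_mul, Finset.sum_sub_distrib, mul_assoc, ← Finset.mul_sum, ite_mul, zero_mul,
      Finset.sum_ite_eq', Finset.mem_univ, if_true, Finset.sum_const_zero] at this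
    simp only [hσ, hT]
    have h2 : (0 : ℤ) ≤ R (.inr (.inr (.inl s))) j := by positivity
    linarith
  have rel2 : ∀ l j, (T l j : ℤ) ≤ N * (∑ k, (h k : ℤ) * σ k j) := by
    intro l j
    have := hR (.inr l) j
    simp only [Fintype.sum_sum_type, c, Sum.elim_inl, Sum.elim_inr] at this
    simp only [mul_assoc, ← Finset.mul_sum, ite_mul, zero_mul,
      Finset.sum_ite_eq', Finset.mem_univ, if_true, Finset.sum_const_zero] at this
    simp only [hσ, hT]
    have h2 : (0 : ℤ) ≤ R (.inr (.inr (.inr l))) j := by positivity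
    linarith
  -- distribute the coefficients of `f l` over the units
  have round : ∀ j, ∃ τ : (Σ k, Fin (σ k j)) → Fin p → ℤ, (∀ l, ∑ i, τ i l = T l j) ∧
      ∀ i l, |(τ i l : ℝ) - h i.1 / (∑ k, (h k : ℝ) * σ k j) * T l j| ≤ 1 := by
    intro j
    by_cases hw : ∑ k, h k * σ k j = 0
    · have hσ0 : ∀ k, σ k j = 0 := by
        intro k
        have := Finset.sum_eq_zero_iff.1 hw k (mem_univ _)
        rcases Nat.mul_eq_zero.1 this with h' | h'
        · exact absurd h' (hh k).ne'
        · exact h'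
      have hw' : (∑ k, (h k : ℤ) * σ k j) = 0 := by exact_mod_cast hw
      have : IsEmpty (Σ k, Fin (σ k j)) := ⟨fun i => by
        have := i.2.2; have := hσ0 i.1; omega⟩
      refine ⟨fun _ _ => 0, fun l => ?_, fun i => (this.false i).elim⟩
      have := rel2 l j
      rw [hw'] at this
      simp; omega
    · have hw' : (∑ k, (h k : ℝ) * σ k j) ≠ 0 := by exact_mod_cast hw
      have hsum : ∑ i : (Σ k, Fin (σ k j)), (h i.1 : ℝ) / (∑ k, (h k : ℝ) * σ k j) = 1 := by
        rw [← Finset.sum_div, Fintype.sum_sigma]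
        simp only [Finset.sum_const, Finset.card_univ, Fintype.card_fin, nsmul_eq_mul]
        rw [div_eq_one_iff_eq hw']
        exact Finset.sum_congr rfl fun k _ => mul_comm _ _
      choose τ h1 h2 using fun l => exists_round _ hsum (T l j : ℤ)
      exact ⟨fun i l => τ l i, h1, fun i l => by simpa using h2 l i⟩
  choose τ hτ1 hτ2 using round
  let E := (Σ j : J, Σ k, Fin (σ k j))
  let e : Fin (Fintype.card E) ≃ E := (Fintype.equivFin E).symm
  refine ⟨Fintype.card E, fun i => (e i).2.1, fun i => z (e i).1, fun i l => τ (e i).1 (e i).2 l,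
    fun i => ⟨hz _, hz0 _⟩, ?_, ?_, ?_⟩
  · intro k
    rw [e.sum_comp (fun i : E => if i.2.1 = k then z i.1 else 0), Fintype.sum_sigma]
    have := hx (.inl k)
    simp only [x, Sum.elim_inl] at this
    rw [this]
    refine Finset.sum_congr rfl fun j _ => ?_
    rw [Fintype.sum_sigma, Finset.sum_eq_single k]
    · simp [hσ]
    · intro k' _ hk; simp [hk]
    · simp
  · intro l
    rw [e.sum_comp (fun i : E => τ i.1 i.2 l • z i.1), Fintype.sum_sigma]
    have := hx (.inr (.inl l))
    simp only [x, Sum.elim_inl, Sum.elim_inr] at this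
    rw [this]
    refine Finset.sum_congr rfl fun j _ => ?_
    simp only
    rw [← Finset.sum_smul, hτ1]
    simp [hT]
  · intro s i
    change 2 ≤ α s (e i).2.1 + ∑ l, b s l * τ (e i).1 (e i).2 l
    generalize e i = i
    obtain ⟨j, k, y⟩ := i
    simp only
    have hσk : 0 < σ k j := lt_of_le_of_lt (Nat.zero_le _) y.2
    set w : ℝ := ∑ k, (h k : ℝ) * σ k j with hw
    have hwpos : 0 < w := by
      refine Finset.sum_pos' (fun k _ => by positivity) ⟨k, mem_univ _, ?_⟩
      have := hh k
      positivity
    have hq' : (0 : ℝ) < q := by exact_mod_cast hq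
    have r1 : w ≤ q * (∑ k, (α s k : ℝ) * σ k j + ∑ l, (b s l : ℝ) * T l j) := by
      rw [hw]; exact_mod_cast rel1 s j
    have r2 : ∑ k, (α s k : ℝ) * σ k j ≤ (θ s + 1 / (4 * q)) * w := by
      rw [hw, Finset.mul_sum]
      refine Finset.sum_le_sum fun k _ => ?_
      have := (abs_le.1 (hα s k)).2
      have h3 : (α s k : ℝ) ≤ (θ s + 1 / (4 * q)) * h k := by
        rw [add_mul, one_div_mul_eq_div]; linarith
      rw [← mul_assoc]
      exact mul_le_mul_of_nonneg_right h3 (by positivity)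
    have r3 : (1 / q - θ s - 1 / (4 * q)) * w ≤ ∑ l, (b s l : ℝ) * T l j := by
      have : w / q ≤ ∑ k, (α s k : ℝ) * σ k j + ∑ l, (b s l : ℝ) * T l j := by
        rw [div_le_iff₀ hq']; linarith
      have e1 : (1 / q - θ s - 1 / (4 * q)) * w = w / q - (θ s + 1 / (4 * q)) * w := by ring
      linarith
    have r4 : (h k : ℝ) / w * ∑ l, (b s l : ℝ) * T l j - ∑ l, |(b s l : ℝ)| ≤
        ∑ l, (b s l : ℝ) * τ j ⟨k, y⟩ l := by
      rw [Finset.mul_sum, ← Finset.sum_sub_distrib]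
      refine Finset.sum_le_sum fun l _ => ?_
      have h1 : |(b s l : ℝ) * (τ j ⟨k, y⟩ l - h k / w * T l j)| ≤ |(b s l : ℝ)| := by
        rw [abs_mul]
        exact mul_le_of_le_one_right (abs_nonneg _) (hτ2 j ⟨k, y⟩ l)
      have h2 := (abs_le.1 h1).1
      have e1 : (b s l : ℝ) * (τ j ⟨k, y⟩ l - h k / w * T l j) =
        (b s l : ℝ) * τ j ⟨k, y⟩ l - h k / w * (b s l * T l j) := by ring
      linarith
    have r5 : (1 / q - θ s - 1 / (4 * q)) * h k ≤ (h k : ℝ) / w * ∑ l, (b s l : ℝ) * T l j := by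
      calc _ = (h k : ℝ) / w * ((1 / q - θ s - 1 / (4 * q)) * w) := by field_simp
        _ ≤ _ := mul_le_mul_of_nonneg_left r3 (by positivity)
    have r6 := (abs_le.1 (hα s k)).1
    have r7 := hbig s k
    have e2 : (1 / q - θ s - 1 / (4 * q)) * h k - (h k : ℝ) / (4 * q) + θ s * h k
        = h k / (2 * q) := by field_simp; ring
    have : (2 : ℝ) ≤ α s k + ∑ l, (b s l : ℝ) * τ j ⟨k, y⟩ l := by linarith
    exact_mod_cast this

end Algebra

lemma exists_lift_basis {G : Type} [AddCommGroup G] {S : Type} [Finite S] (N : AddSubgroup G)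
    (htf : ∀ (g : G) (n : ℕ), 0 < n → n • g ∈ N → g ∈ N) (g : S → G) :
    ∃ (p : ℕ) (f : Fin p → G) (b : S → Fin p → ℤ), (∀ s, g s - ∑ l, b s l • f l ∈ N) ∧
      ∀ n : Fin p → ℤ, ∑ l, n l • f l ∈ N → n = 0 := by
  let π : G →+ G ⧸ N := QuotientAddGroup.mk' N
  have htor : Module.IsTorsionFree ℤ (G ⧸ N) := by
    rw [Module.isTorsionFree_int_iff_isAddTorsionFree]
    refine ⟨fun n hn x y hxy => ?_⟩
    simp only at hxy
    obtain ⟨x, rfl⟩ := QuotientAddGroup.mk'_surjective N x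
    obtain ⟨y, rfl⟩ := QuotientAddGroup.mk'_surjective N y
    rw [← sub_eq_zero, ← smul_sub, ← map_sub, ← map_nsmul] at hxy
    rw [← sub_eq_zero, ← map_sub]
    simp only [QuotientAddGroup.mk'_apply, QuotientAddGroup.eq_zero_iff] at hxy ⊢
    exact htf _ n (Nat.pos_of_ne_zero hn) hxy
  let W : Submodule ℤ (G ⧸ N) := Submodule.span ℤ (Set.range fun s => π (g s))
  have : Module.Finite ℤ W := Module.Finite.span_of_finite ℤ (Set.finite_range _)
  have : Module.Free ℤ W := inferInstance
  let B := Module.finBasis ℤ W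
  choose f hf using fun l => QuotientAddGroup.mk'_surjective N (B l : G ⧸ N)
  refine ⟨_, f, fun s l => B.repr ⟨π (g s), Submodule.subset_span ⟨s, rfl⟩⟩ l, ?_, ?_⟩
  · intro s
    rw [← QuotientAddGroup.eq_zero_iff, ← QuotientAddGroup.mk'_apply, map_sub, map_sum]
    simp_rw [map_zsmul, hf]
    have := congrArg (Subtype.val) (B.sum_repr ⟨π (g s), Submodule.subset_span ⟨s, rfl⟩⟩)
    rw [Submodule.coe_sum] at this
    simp only [Submodule.coe_smul] at this
    rw [this, sub_self]
  · intro n hn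
    rw [← QuotientAddGroup.eq_zero_iff, ← QuotientAddGroup.mk'_apply, map_sum] at hn
    simp_rw [map_zsmul, hf] at hn
    have h2 : ∑ l, n l • B l = 0 := by
      apply Subtype.ext
      rw [Submodule.coe_sum]
      simpa using hn
    funext l
    exact Fintype.linearIndependent_iff.1 B.linearIndependent n h2 l

/-- Labelling a finite set with prescribed fibre cardinalities. -/
lemma exists_labelling_aux {L : Type*} [Nonempty L] [DecidableEq L] (M : L → ℕ) (B : Finset L)
    (A : Finset ℕ) (h : #A = ∑ l ∈ B, M l) :
    ∃ w : ℕ → L, (∀ i ∈ A, w i ∈ B) ∧ ∀ l ∈ B, #{i ∈ A | w i = l} = M l := by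
  induction B using Finset.induction_on generalizing A with
  | empty =>
    obtain rfl : A = ∅ := by simpa using h
    exact ⟨fun _ => Classical.arbitrary L, by simp, by simp⟩
  | insert l B hl ih =>
    rw [Finset.sum_insert hl] at h
    obtain ⟨A₁, hA₁, hc⟩ := Finset.exists_subset_card_eq (s := A) (n := M l) (by omega)
    obtain ⟨w, hw, hw'⟩ := ih (A \ A₁) (by rw [Finset.card_sdiff_of_subset hA₁]; omega)
    refine ⟨fun i => if i ∈ A₁ then l else w i, ?_, ?_⟩
    · intro i hi
      by_cases h1 : i ∈ A₁
      · simp [h1]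
      · simp only [h1, if_false]
        exact Finset.mem_insert_of_mem (hw i (by simp [hi, h1]))
    · intro l' hl'
      rcases Finset.mem_insert.1 hl' with rfl | hB
      · rw [← hc]
        congr 1
        ext i
        simp only [Finset.mem_filter]
        constructor
        · rintro ⟨hi, h2⟩
          by_contra h1
          simp only [h1, if_false] at h2
          exact hl (h2 ▸ hw i (by simp [hi, h1]))
        · intro hi
          exact ⟨hA₁ hi, by simp [hi]⟩
      · rw [← hw' l' hB]
        congr 1
        ext i
        simp only [Finset.mem_filter, Finset.mem_sdiff]
        have hne : l ≠ l' := fun e => hl (e ▸ hB)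
        by_cases h1 : i ∈ A₁ <;> simp [h1, hne]

lemma card_filter_swap {L : Type*} [DecidableEq L] (A : Finset ℕ) (w : ℕ → L) {i j : ℕ}
    (hi : i ∈ A) (hj : j ∈ A) (l : L) :
    #{a ∈ A | w (Equiv.swap i j a) = l} = #{a ∈ A | w a = l} := by
  refine Finset.card_equiv (Equiv.swap i j) fun a => ?_
  simp only [Finset.mem_filter]
  have : Equiv.swap i j a ∈ A ↔ a ∈ A := by
    rw [Equiv.swap_apply_def]
    split_ifs with h1 h2
    · simp [h1, hi, hj]
    · simp [h2, hi, hj]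
    · rfl
  rw [this]

/-- Labelling over a colouring, with prescribed fibre cardinalities and two prescribed labels. -/
lemma exists_labelling {L K : Type*} [Fintype L] [DecidableEq L] [DecidableEq K]
    (M : L → ℕ) (base : L → K) (A : Finset ℕ) (κ : ℕ → K)
    (hM : ∀ k, (∑ l, if base l = k then M l else 0) = #{i ∈ A | κ i = k}) (h2 : ∀ l, 2 ≤ M l)
    {i₁ i₂ : ℕ} (hi₁ : i₁ ∈ A) (hi₂ : i₂ ∈ A) (hne : i₁ ≠ i₂) {l₁ l₂ : L}
    (hl₁ : base l₁ = κ i₁) (hl₂ : base l₂ = κ i₂) :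
    ∃ w : ℕ → L, (∀ i ∈ A, base (w i) = κ i) ∧ (∀ l, #{i ∈ A | w i = l} = M l) ∧
      w i₁ = l₁ ∧ w i₂ = l₂ := by
  have : Nonempty L := ⟨l₁⟩
  obtain ⟨w, hw, hwc⟩ : ∃ w : ℕ → L, (∀ i ∈ A, base (w i) = κ i) ∧
      ∀ l, #{i ∈ A | w i = l} = M l := by
    have := fun k => exists_labelling_aux M ({l | base l = k} : Finset L)
      ({i ∈ A | κ i = k}) (by rw [Finset.sum_filter, hM])
    choose w h1 h2 using this
    have h1' : ∀ i ∈ A, base (w (κ i) i) = κ i := fun i hi => by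
      simpa using h1 (κ i) i (by simp [hi])
    refine ⟨fun i => w (κ i) i, h1', fun l => ?_⟩
    rw [← h2 (base l) l (by simp)]
    congr 1
    ext i
    simp only [Finset.mem_filter]
    constructor
    · rintro ⟨hi, e⟩
      have := h1' i hi
      rw [e] at this
      exact ⟨⟨hi, this.symm⟩, by rw [this, e]⟩
    · rintro ⟨⟨hi, e⟩, e'⟩
      exact ⟨hi, by rw [e, e']⟩
  have swap : ∀ w : ℕ → L, (∀ i ∈ A, base (w i) = κ i) → (∀ l, #{i ∈ A | w i = l} = M l) →
      ∀ i ∈ A, ∀ j ∈ A, κ i = κ j →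
      (∀ a ∈ A, base (w (Equiv.swap i j a)) = κ a) ∧
      ∀ l, #{a ∈ A | w (Equiv.swap i j a) = l} = M l := by
    intro w hw hwc i hi j hj hij
    refine ⟨fun a ha => ?_, fun l => by rw [card_filter_swap A w hi hj, hwc]⟩
    rw [Equiv.swap_apply_def]
    split_ifs with e1 e2
    · rw [hw j hj, e1, hij]
    · rw [hw i hi, e2, hij]
    · exact hw a ha
  obtain ⟨j₁, hj₁⟩ : ({i ∈ A | w i = l₁} : Finset ℕ).Nonempty := by
    rw [← Finset.card_pos, hwc]; have := h2 l₁; omega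
  simp only [Finset.mem_filter] at hj₁
  have hκ₁ : κ i₁ = κ j₁ := by rw [← hl₁, ← hj₁.2, hw _ hj₁.1]
  obtain ⟨hw', hwc'⟩ := swap w hw hwc i₁ hi₁ j₁ hj₁.1 hκ₁
  set w' : ℕ → L := fun a => w (Equiv.swap i₁ j₁ a) with hw'def
  have hw'1 : w' i₁ = l₁ := by simp [hw'def, hj₁.2]
  obtain ⟨j₂, hj₂, hj₂ne⟩ := Finset.exists_mem_ne (s := {i ∈ A | w' i = l₂})
    (by rw [hwc']; have := h2 l₂; omega) i₁
  simp only [Finset.mem_filter] at hj₂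
  have hκ₂ : κ i₂ = κ j₂ := by rw [← hl₂, ← hj₂.2, hw' _ hj₂.1]
  obtain ⟨hw'', hwc''⟩ := swap w' hw' hwc' i₂ hi₂ j₂ hj₂.1 hκ₂
  refine ⟨_, hw'', hwc'', ?_, ?_⟩
  · rw [Equiv.swap_apply_of_ne_of_ne hne hj₂ne.symm, hw'1]
  · simp [hj₂.2]

section Dynamics
open Filter Topology
variable (M : MinimalCantorSystem)

lemma pow_toEquiv_natCast (n : ℕ) (x : M.X) : (M.T.toEquiv ^ (n : ℤ)) x = M.T^[n] x := by
  rw [zpow_natCast, ← Equiv.Perm.iterate_eq_pow]; rfl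

lemma pow_toEquiv_neg (n : ℕ) (x : M.X) : (M.T.toEquiv ^ (-(n : ℤ))) x = M.T.symm^[n] x := by
  rw [zpow_neg, zpow_natCast, ← inv_pow, ← Equiv.Perm.iterate_eq_pow]; rfl

lemma continuous_pow_toEquiv (n : ℤ) : Continuous fun x : M.X => (M.T.toEquiv ^ n) x := by
  obtain ⟨k, rfl | rfl⟩ := n.eq_nat_or_neg
  · simp only [pow_toEquiv_natCast]; exact M.T.continuous.iterate k
  · simp only [pow_toEquiv_neg]; exact M.T.symm.continuous.iterate k

lemma exists_pow_mem {U : Set M.X} (hU : IsOpen U) (hne : U.Nonempty) :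
    ∃ N : ℕ, ∀ x : M.X, ∃ n : ℤ, |n| ≤ N ∧ (M.T.toEquiv ^ n) x ∈ U := by
  have hcov : (Set.univ : Set M.X) ⊆ ⋃ n : ℤ, (fun x : M.X => (M.T.toEquiv ^ n) x) ⁻¹' U := by
    intro x _
    obtain ⟨_, ⟨n, rfl⟩, hy⟩ := (M.minimal x).exists_mem_open hU hne
    exact Set.mem_iUnion.2 ⟨n, hy⟩
  obtain ⟨t, ht⟩ := isCompact_univ.elim_finite_subcover _
    (fun n => hU.preimage (continuous_pow_toEquiv M n)) hcov
  refine ⟨∑ n ∈ t, n.natAbs, fun x => ?_⟩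
  obtain ⟨n, hn, hx⟩ := Set.mem_iUnion₂.1 (ht (Set.mem_univ x))
  refine ⟨n, ?_, hx⟩
  have := Finset.single_le_sum (f := fun n : ℤ => n.natAbs) (fun _ _ => Nat.zero_le _) hn
  rw [Int.abs_eq_natAbs]; exact_mod_cast this

lemma exists_iterate_mem {U : Set M.X} (hU : IsOpen U) (hne : U.Nonempty) :
    ∃ N : ℕ, ∀ x : M.X, ∃ i : ℕ, 0 < i ∧ i ≤ N ∧ M.T^[i] x ∈ U := by
  obtain ⟨N, hN⟩ := exists_pow_mem M hU hne
  refine ⟨2 * N + 1, fun x => ?_⟩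
  obtain ⟨n, hn, hx⟩ := hN (M.T^[N + 1] x)
  rw [abs_le] at hn
  refine ⟨(n + (N + 1)).toNat, by omega, by omega, ?_⟩
  rw [← pow_toEquiv_natCast, Int.toNat_of_nonneg (by omega), zpow_add, Equiv.Perm.mul_apply]
  rw [← pow_toEquiv_natCast] at hx
  exact_mod_cast hx

lemma exists_iterate_symm_mem {U : Set M.X} (hU : IsOpen U) (hne : U.Nonempty) :
    ∃ N : ℕ, ∀ x : M.X, ∃ i : ℕ, 0 < i ∧ i ≤ N ∧ M.T.symm^[i] x ∈ U := by
  obtain ⟨N, hN⟩ := exists_pow_mem M hU hne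
  refine ⟨2 * N + 1, fun x => ?_⟩
  obtain ⟨n, hn, hx⟩ := hN (M.T.symm^[N + 1] x)
  rw [abs_le] at hn
  refine ⟨(-(n - (N + 1))).toNat, by omega, by omega, ?_⟩
  rw [← pow_toEquiv_neg, Int.toNat_of_nonneg (by omega), neg_neg, sub_eq_add_neg, zpow_add,
    Equiv.Perm.mul_apply]
  rw [← pow_toEquiv_neg] at hx
  exact_mod_cast hx

open Classical in
lemma iterate_ne (x : M.X) {i : ℕ} (hi : 0 < i) : M.T^[i] x ≠ x := by
  intro h
  have hr : Set.range (fun n : ℤ => (M.T.toEquiv ^ n) x) ⊆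
      (Finset.range i).image (fun k => M.T^[k] x) := by
    rintro _ ⟨n, rfl⟩
    have hp : (M.T.toEquiv ^ (i : ℤ)) x = x := by rw [pow_toEquiv_natCast, h]
    have h1 : (M.T.toEquiv ^ n) x = (M.T.toEquiv ^ (n % i)) x := by
      conv_lhs => rw [← Int.emod_add_mul_ediv n i, zpow_add, Equiv.Perm.mul_apply, zpow_mul]
      rw [Equiv.Perm.zpow_apply_eq_self_of_apply_eq_self hp]
    have h2 := Int.emod_nonneg n (b := i) (by omega)
    have h3 := Int.emod_lt_of_pos n (b := i) (by omega)
    simp only [Finset.coe_image, Set.mem_image, Finset.mem_coe, Finset.mem_range]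
    refine ⟨(n % i).toNat, by omega, ?_⟩
    rw [h1, ← pow_toEquiv_natCast, Int.toNat_of_nonneg h2]
  have hfin := (Finset.finite_toSet _).subset hr
  have huniv : (Set.univ : Set M.X).Finite := by
    rw [← (M.minimal x).closure_eq, hfin.isClosed.closure_eq]; exact hfin
  have : Finite M.X := Set.finite_univ_iff.1 huniv
  exact M.noIsolated x (isOpen_discrete _)

lemma exists_bound (f : C(M.X, ℤ)) : ∃ C : ℕ, ∀ x, |f x| ≤ C := by
  obtain ⟨C, hC⟩ := isCompact_univ.exists_bound_of_continuousOn f.continuous.continuousOn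
  refine ⟨⌈C⌉₊, fun x => ?_⟩
  have h1 := hC x (Set.mem_univ x)
  have h2 := h1.trans (Nat.le_ceil C)
  rw [Int.norm_eq_abs] at h2
  exact_mod_cast h2

variable {M}

/-- A clopen indicator function. -/
noncomputable def ind {B : Set M.X} (hB : IsClopen B) : C(M.X, ℤ) :=
  ⟨B.indicator 1, by
    exact continuous_const.indicator (by simp [hB.frontier_eq])⟩

open Classical in
lemma ind_apply {B : Set M.X} (hB : IsClopen B) (x : M.X) : ind hB x = if x ∈ B then 1 else 0 := by
  simp [ind, Set.indicator_apply]

lemma ind_notMem_range {B : Set M.X} (hB : IsClopen B) (hne : B.Nonempty) :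
    ind hB ∉ (cobMap M).range := by
  rintro ⟨g, hg⟩
  have hg' : ∀ x, g (M.T x) - g x = ind hB x := fun x => by rw [← hg]; rfl
  obtain ⟨x, -, hx⟩ := isCompact_univ.exists_isMaxOn Set.univ_nonempty g.continuous.continuousOn
  have hmax : ∀ y, g y ≤ g x := fun y => hx (Set.mem_univ y)
  have hmono : ∀ y, g y ≤ g (M.T y) := fun y => by
    have := hg' y
    rw [ind_apply] at this
    split_ifs at this <;> omega
  have hst : ∀ i, g (M.T^[i] x) = g x := by
    intro i
    induction i with
    | zero => rfl
    | succ i ih =>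
      rw [Function.iterate_succ_apply']
      exact le_antisymm (hmax _) (ih ▸ hmono _)
  obtain ⟨N, hN⟩ := exists_iterate_mem M hB.isOpen hne
  obtain ⟨i, -, -, hi⟩ := hN x
  have h1 := hg' (M.T^[i] x)
  rw [← Function.iterate_succ_apply' M.T, hst, hst, ind_apply, if_pos hi] at h1
  omega

lemma exists_average (huT : ∃! τ : K0 M →+ ℝ, IsTrace (posCone M) (unitClass M) τ) :
    ∃ τ : C(M.X, ℤ) → ℝ, ∀ f : C(M.X, ℤ), ∀ η : ℝ, 0 < η → ∃ N : ℕ, ∀ n ≥ N, ∀ x : M.X,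
      |((∑ i ∈ Finset.range n, f (M.T^[i] x) : ℤ) : ℝ) - n * τ f| ≤ η * n := by
  obtain ⟨τ, hτ, hu⟩ := huT
  let mk : C(M.X, ℤ) →+ K0 M := QuotientAddGroup.mk' (cobMap M).range
  refine ⟨fun f => τ (mk f), fun f η hη => ?_⟩
  by_contra! hcon
  have hcon' : ∀ N : ℕ, ∃ n, N + 1 ≤ n ∧ ∃ x : M.X,
      η * n < |((∑ i ∈ Finset.range n, f (M.T^[i] x) : ℤ) : ℝ) - n * τ (mk f)| :=
    fun N => hcon (N + 1)
  choose n hn x hx using hcon'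
  have hn0 : ∀ N, (0 : ℝ) < n N := fun N => by exact_mod_cast (by have := hn N; omega : 0 < n N)
  let av : C(M.X, ℤ) → ℕ → ℝ := fun g N =>
    ((∑ i ∈ Finset.range (n N), g (M.T^[i] (x N)) : ℤ) : ℝ) / n N
  have hbd : ∀ g : C(M.X, ℤ), ∃ L, Tendsto (av g) (hyperfilter ℕ) (𝓝 L) := by
    intro g
    obtain ⟨C, hC⟩ := exists_bound M g
    have hmem : ∀ N, av g N ∈ Set.Icc (-(C : ℝ)) C := by
      intro N
      rw [Set.mem_Icc, ← abs_le]
      simp only [av]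
      rw [abs_div, abs_of_pos (hn0 N), div_le_iff₀ (hn0 N)]
      have : |∑ i ∈ Finset.range (n N), g (M.T^[i] (x N))| ≤ C * n N := by
        refine (Finset.abs_sum_le_sum_abs _ _).trans ?_
        refine (Finset.sum_le_card_nsmul _ _ _ fun i _ => hC _).trans ?_
        simp [mul_comm]
      exact_mod_cast this
    obtain ⟨L, -, hL⟩ := (isCompact_Icc (a := -(C : ℝ)) (b := C)).ultrafilter_le_nhds
      ((hyperfilter ℕ).map (av g)) (by
        rw [Ultrafilter.coe_map]
        exact le_principal_iff.2 (mem_map.2 (univ_mem' hmem)))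
    exact ⟨L, hL⟩
  choose L hL using hbd
  have hinv : Tendsto (fun N => (1 : ℝ) / n N) (hyperfilter ℕ) (𝓝 0) := by
    have : Tendsto (fun N => (1 : ℝ) / n N) atTop (𝓝 0) := by
      have h1 : Tendsto n atTop atTop :=
        tendsto_atTop_mono (fun N => (Nat.le_succ N).trans (hn N)) tendsto_id
      exact (tendsto_const_div_atTop_nhds_zero_nat (1 : ℝ)).comp h1
    exact this.mono_left (Nat.hyperfilter_le_atTop)
  let Lh : C(M.X, ℤ) →+ ℝ := AddMonoidHom.mk' L (by
    intro g h
    refine tendsto_nhds_unique (hL (g + h)) (((hL g).add (hL h)).congr fun N => ?_)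
    simp only [av, ContinuousMap.add_apply, Finset.sum_add_distrib, Int.cast_add, add_div])
  have hker : (cobMap M).range ≤ Lh.ker := by
    rintro _ ⟨g, rfl⟩
    rw [AddMonoidHom.mem_ker]
    obtain ⟨C, hC⟩ := exists_bound M g
    refine tendsto_nhds_unique (hL _) (squeeze_zero_norm (fun N => ?_)
      ((hinv.const_mul (2 * (C : ℝ))).trans (by rw [mul_zero])))
    have : ∑ i ∈ Finset.range (n N), (cobMap M g) (M.T^[i] (x N)) =
        g (M.T^[n N] (x N)) - g (x N) := by
      refine Eq.trans ?_ (Finset.sum_range_sub (fun i => g (M.T^[i] (x N))) (n N))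
      refine Finset.sum_congr rfl fun i _ => ?_
      rw [Function.iterate_succ_apply']; rfl
    simp only [av, this]
    rw [norm_div, Real.norm_of_nonneg (hn0 N).le, div_eq_mul_one_div]
    refine mul_le_mul_of_nonneg_right ?_ (one_div_nonneg.2 (hn0 N).le)
    rw [Real.norm_eq_abs]
    have h1 := hC (M.T^[n N] (x N))
    have h2 := hC (x N)
    have : |g (M.T^[n N] (x N)) - g (x N)| ≤ 2 * (C : ℤ) := by
      rw [abs_le] at *; constructor <;> linarith [h1.1, h1.2, h2.1, h2.2]
    exact_mod_cast this
  let τ' : K0 M →+ ℝ := QuotientAddGroup.lift (cobMap M).range Lh hker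
  have hτ'mk : ∀ g, τ' (mk g) = L g := fun g => QuotientAddGroup.lift_mk' _ hker g
  have htr : IsTrace (posCone M) (unitClass M) τ' := by
    constructor
    · rintro _ ⟨g, hg, rfl⟩
      change 0 ≤ τ' (mk g)
      rw [hτ'mk]
      refine ge_of_tendsto' (hL g) fun N => div_nonneg ?_ (hn0 N).le
      exact_mod_cast Finset.sum_nonneg fun i _ => hg _
    · change τ' (mk 1) = 1
      rw [hτ'mk]
      refine tendsto_nhds_unique (hL 1) (tendsto_const_nhds.congr fun N => ?_)
      have := (hn0 N).ne'
      simp [av, this]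
  have hLf : L f = τ (mk f) := by rw [← hτ'mk, hu τ' htr]
  have hlim : η ≤ |L f - τ (mk f)| := by
    refine ge_of_tendsto' ((hL f).sub_const (τ (mk f))).abs fun N => ?_
    have h1 := hx N
    have h2 : av f N - τ (mk f) = (((∑ i ∈ Finset.range (n N), f (M.T^[i] (x N)) : ℤ) : ℝ)
        - n N * τ (mk f)) / n N := by
      have := (hn0 N).ne'
      simp only [av]; field_simp
    rw [h2, abs_div, abs_of_pos (hn0 N), le_div_iff₀ (hn0 N)]
    exact h1.le
  rw [hLf, sub_self, abs_zero] at hlim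
  linarith

end Dynamics

section Towers
open Filter Topology
variable {M : MinimalCantorSystem}

/-- A Kakutani–Rokhlin structure: `κ` names the tower of a point, `lev` is its level in the tower
and `ht` gives the heights. -/
structure IsKR (M : MinimalCantorSystem) {K : Type} (κ : M.X → K) (lev : M.X → ℕ) (ht : K → ℕ) :
    Prop where
  tower : IsLocallyConstant κ
  level : IsLocallyConstant lev
  top : ∀ z, lev (M.T z) = 0 → lev z + 1 = ht (κ z)
  step : ∀ z, lev (M.T z) ≠ 0 → lev (M.T z) = lev z + 1 ∧ κ (M.T z) = κ z
  lt : ∀ z, lev z < ht (κ z)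

namespace IsKR
variable {K : Type} {κ : M.X → K} {lev : M.X → ℕ} {ht : K → ℕ}

lemma walk (h : IsKR M κ lev ht) (z : M.X) (i : ℕ) (hi : lev z + i < ht (κ z)) :
    lev (M.T^[i] z) = lev z + i ∧ κ (M.T^[i] z) = κ z := by
  induction i with
  | zero => simp
  | succ i ih =>
    obtain ⟨h1, h2⟩ := ih (by omega)
    rw [Function.iterate_succ_apply']
    have h3 : lev (M.T (M.T^[i] z)) ≠ 0 := fun h0 => by
      have := h.top _ h0
      rw [h1, h2] at this; omega
    obtain ⟨h4, h5⟩ := h.step _ h3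
    exact ⟨by omega, by rw [h5, h2]⟩

lemma walk_bot (h : IsKR M κ lev ht) {z : M.X} (hz : lev z = 0) (i : ℕ) (hi : i < ht (κ z)) :
    lev (M.T^[i] z) = i ∧ κ (M.T^[i] z) = κ z := by
  have := h.walk z i (by omega)
  rwa [hz, zero_add] at this

lemma exists_bot (h : IsKR M κ lev ht) (z : M.X) :
    ∃ b, lev b = 0 ∧ κ b = κ z ∧ M.T^[lev z] b = z := by
  induction hl : lev z generalizing z with
  | zero => exact ⟨z, hl, rfl, rfl⟩
  | succ l ih =>
    obtain ⟨y, rfl⟩ := M.T.surjective z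
    obtain ⟨h1, h2⟩ := h.step y (by omega)
    obtain ⟨b, hb, hκ, hT⟩ := ih y (by omega)
    exact ⟨b, hb, hκ.trans h2.symm, by rw [Function.iterate_succ_apply', hT]⟩

lemma ht_pos (h : IsKR M κ lev ht) (z : M.X) : 0 < ht (κ z) := (Nat.zero_le _).trans_lt (h.lt z)

lemma return_bot (h : IsKR M κ lev ht) {z : M.X} (hz : lev z = 0) :
    lev (M.T^[ht (κ z)] z) = 0 := by
  have h0 := h.ht_pos z
  obtain ⟨h1, h2⟩ := h.walk_bot hz (ht (κ z) - 1) (by omega)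
  have h3 : M.T^[ht (κ z)] z = M.T (M.T^[ht (κ z) - 1] z) := by
    rw [← Function.iterate_succ_apply' M.T]; congr 1; omega
  rw [h3]
  by_contra h4
  obtain ⟨h5, h6⟩ := h.step _ h4
  have := h.lt (M.T (M.T^[ht (κ z) - 1] z))
  rw [h6, h2] at this; omega

lemma isClopen_bot (h : IsKR M κ lev ht) (k : K) : IsClopen {z | κ z = k ∧ lev z = 0} :=
  (h.tower.isClopen_fiber k).inter (h.level.isClopen_fiber 0)

/-- The indicator function of the bottom of a tower. -/
noncomputable def bot (h : IsKR M κ lev ht) (k : K) : C(M.X, ℤ) := ind (h.isClopen_bot k)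

lemma bot_apply (h : IsKR M κ lev ht) (k : K) (z : M.X) [Decidable (κ z = k ∧ lev z = 0)] :
    h.bot k z = if κ z = k ∧ lev z = 0 then 1 else 0 := by
  rw [bot, ind_apply, Set.mem_ofPred_eq]
  congr

lemma exists_cobMap_eq (h : IsKR M κ lev ht) (F : K → ℕ → ℤ)
    (hF : ∀ k, ∑ i ∈ range (ht k), F k i = 0)
    (f : C(M.X, ℤ)) (hf : ∀ z, f z = F (κ z) (lev z)) :
    ∃ g, cobMap M g = f ∧ ∀ z, lev z = 0 → g z = 0 := by
  let G : K × ℕ → ℤ := fun p => ∑ i ∈ range p.2, F p.1 i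
  have hpair : IsLocallyConstant fun z => (κ z, lev z) := h.tower.prodMk h.level
  refine ⟨⟨fun z => G (κ z, lev z), (hpair.comp G).continuous⟩, ?_, fun z hz => by
    simp [G, hz]⟩
  ext z
  change G (κ (M.T z), lev (M.T z)) - G (κ z, lev z) = f z
  rw [hf]
  by_cases h0 : lev (M.T z) = 0
  · have h1 := hF (κ z)
    rw [← h.top z h0, sum_range_succ] at h1
    simp only [G, h0, range_zero, sum_empty]
    omega
  · obtain ⟨h1, h2⟩ := h.step z h0
    simp only [G, h1, h2, sum_range_succ]
    ring

lemma exists_cobMap_eq_sub_sum_bot (h : IsKR M κ lev ht) [Fintype K] (F : K → ℕ → ℤ)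
    (f : C(M.X, ℤ)) (hf : ∀ z, f z = F (κ z) (lev z)) :
    ∃ g, cobMap M g = f - ∑ k, (∑ i ∈ range (ht k), F k i) • h.bot k ∧
      ∀ z, lev z = 0 → g z = 0 := by
  classical
  refine h.exists_cobMap_eq
    (fun k i => F k i - if i = 0 then ∑ i ∈ range (ht k), F k i else 0) (fun k => ?_) _ fun z => ?_
  · rw [sum_sub_distrib, sum_ite_eq' (range (ht k)) 0]
    split_ifs with h0
    · exact sub_self _
    · have : ht k = 0 := by simpa using h0
      simp [this]
  · rw [ContinuousMap.sub_apply, hf, ContinuousMap.coe_sum, Finset.sum_apply]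
    congr 1
    rw [Finset.sum_eq_single (κ z)]
    · simp [bot_apply]
    · intro k _ hk
      simp [bot_apply, hk.symm]
    · simp

lemma sub_sum_bot_mem_range (h : IsKR M κ lev ht) [Fintype K] (F : K → ℕ → ℤ)
    (f : C(M.X, ℤ)) (hf : ∀ z, f z = F (κ z) (lev z)) :
    f - ∑ k, (∑ i ∈ range (ht k), F k i) • h.bot k ∈ (cobMap M).range :=
  let ⟨g, hg, _⟩ := h.exists_cobMap_eq_sub_sum_bot F f hf
  ⟨g, hg⟩

end IsKR

lemma sum_cobMap_iterate {g : C(M.X, ℤ)} {F : ℕ → ℤ} {b : M.X} {n : ℕ}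
    (hF : ∀ i < n, cobMap M g (M.T^[i] b) = F i) :
    ∑ i ∈ range n, F i = g (M.T^[n] b) - g b := by
  refine Eq.trans (sum_congr rfl fun i hi => ?_)
    (Finset.sum_range_sub (fun i => g (M.T^[i] b)) n)
  rw [← hF i (mem_range.1 hi), Function.iterate_succ_apply']; rfl

lemma exists_isKR {U : Set M.X} (hU : IsClopen U) (hne : U.Nonempty) {α : Type} (Θ : M.X → α)
    (hΘ : IsLocallyConstant Θ) :
    ∃ (q : ℕ) (κ : M.X → Fin q) (lev : M.X → ℕ) (ht : Fin q → ℕ) (F : Fin q → ℕ → α),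
      IsKR M κ lev ht ∧ Function.Surjective κ ∧ (∀ x, lev x = 0 ↔ x ∈ U) ∧
      ∀ x, Θ x = F (κ x) (lev x) := by
  classical
  obtain ⟨N₁, hN₁⟩ := exists_iterate_symm_mem M hU.isOpen hne
  obtain ⟨N₂, hN₂⟩ := exists_iterate_mem M hU.isOpen hne
  have hex₁ : ∀ x, ∃ i, M.T.symm^[i] x ∈ U := fun x =>
    let ⟨i, _, _, hi⟩ := hN₁ x; ⟨i, hi⟩
  have hex₂ : ∀ x, ∃ i, 0 < i ∧ M.T^[i] x ∈ U := fun x =>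
    let ⟨i, h0, _, hi⟩ := hN₂ x; ⟨i, h0, hi⟩
  let lev : M.X → ℕ := fun x => Nat.find (hex₁ x)
  let ret : M.X → ℕ := fun x => Nat.find (hex₂ x)
  have hUev : ∀ (f : M.X → M.X), Continuous f → ∀ x, ∀ᶠ y in 𝓝 x, (f y ∈ U ↔ f x ∈ U) := by
    intro f hf x
    by_cases hx : f x ∈ U
    · filter_upwards [(hU.isOpen.preimage hf).mem_nhds hx] with y hy
      exact iff_of_true hy hx
    · filter_upwards [(hU.compl.isOpen.preimage hf).mem_nhds hx] with y hy
      exact iff_of_false hy hx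
  have hlev : IsLocallyConstant lev := by
    rw [IsLocallyConstant.iff_eventually_eq]
    intro x
    have : ∀ᶠ y in 𝓝 x, ∀ i ∈ range (lev x + 1), (M.T.symm^[i] y ∈ U ↔ M.T.symm^[i] x ∈ U) :=
      (Filter.eventually_all_finset _).2 fun i _ => hUev _ (M.T.symm.continuous.iterate i) x
    filter_upwards [this] with y hy
    refine (Nat.find_eq_iff _).2 ⟨(hy _ (by simp)).2 (Nat.find_spec (hex₁ x)), fun i hi => ?_⟩
    rw [hy i (by simp; omega)]
    exact Nat.find_min (hex₁ x) hi
  have hret : IsLocallyConstant ret := by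
    rw [IsLocallyConstant.iff_eventually_eq]
    intro x
    have : ∀ᶠ y in 𝓝 x, ∀ i ∈ range (ret x + 1), (M.T^[i] y ∈ U ↔ M.T^[i] x ∈ U) :=
      (Filter.eventually_all_finset _).2 fun i _ => hUev _ (M.T.continuous.iterate i) x
    filter_upwards [this] with y hy
    refine (Nat.find_eq_iff _).2 ⟨⟨(Nat.find_spec (hex₂ x)).1,
      (hy _ (by simp)).2 (Nat.find_spec (hex₂ x)).2⟩, fun i hi => ?_⟩
    rw [hy i (by simp; omega)]
    exact Nat.find_min (hex₂ x) hi
  let b : M.X → M.X := fun x => M.T.symm^[lev x] x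
  have hb : Continuous b := by
    rw [continuous_iff_continuousAt]
    intro x
    refine (M.T.symm.continuous.iterate (lev x)).continuousAt.congr ?_
    filter_upwards [(IsLocallyConstant.iff_eventually_eq _).1 hlev x] with y hy
    simp only [b, hy]
  let L : M.X → List α := fun z => (List.range (ret z)).map fun i => Θ (M.T^[i] z)
  have hL : IsLocallyConstant L := by
    rw [IsLocallyConstant.iff_eventually_eq]
    intro x
    have : ∀ᶠ y in 𝓝 x, ∀ i ∈ range (ret x), Θ (M.T^[i] y) = Θ (M.T^[i] x) :=
      (Filter.eventually_all_finset _).2 fun i _ =>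
        (IsLocallyConstant.iff_eventually_eq _).1
          (hΘ.comp_continuous (M.T.continuous.iterate i)) x
    filter_upwards [this, (IsLocallyConstant.iff_eventually_eq _).1 hret x] with y hy hy'
    simp only [L, hy']
    exact List.map_congr_left fun i hi => hy i (by simpa using hi)
  have hLb : IsLocallyConstant (L ∘ b) := hL.comp_continuous hb
  have hTb : ∀ x i, i ≤ lev x → M.T^[i] (b x) = M.T.symm^[lev x - i] x := by
    intro x i hi
    have hinv : Function.LeftInverse (M.T) (M.T.symm) := M.T.apply_symm_apply
    simp only [b]
    conv_lhs => rw [show lev x = i + (lev x - i) by omega, Function.iterate_add_apply]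
    exact hinv.iterate i _
  have hlt : ∀ x, lev x < ret (b x) := by
    intro x
    by_contra! hle
    obtain ⟨h1, h2⟩ := Nat.find_spec (hex₂ (b x))
    change 0 < ret (b x) at h1
    change M.T^[ret (b x)] (b x) ∈ U at h2
    rw [hTb x _ hle] at h2
    exact Nat.find_min (hex₁ x) (show lev x - ret (b x) < lev x by omega) h2
  have hlev0 : ∀ x, lev x = 0 ↔ x ∈ U := fun x => by simp [lev, Nat.find_eq_zero]
  have hsucc : ∀ x, lev (M.T x) ≠ 0 → lev (M.T x) = lev x + 1 := by
    intro x hx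
    refine (Nat.find_eq_iff _).2 ⟨?_, fun i hi => ?_⟩
    · rw [Function.iterate_succ_apply, M.T.symm_apply_apply]
      exact Nat.find_spec (hex₁ x)
    · cases i with
      | zero => exact fun h' => hx ((hlev0 _).2 h')
      | succ i =>
        rw [Function.iterate_succ_apply, M.T.symm_apply_apply]
        exact Nat.find_min (hex₁ x) (show i < lev x by omega)
  have hbsucc : ∀ x, lev (M.T x) ≠ 0 → b (M.T x) = b x := by
    intro x hx
    simp only [b]
    rw [hsucc x hx, Function.iterate_succ_apply, M.T.symm_apply_apply]
  have : Finite (Set.range (L ∘ b)) := hLb.range_finite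
  let e := Finite.equivFin (Set.range (L ∘ b))
  obtain ⟨x₀, -⟩ := hne
  have hprf : ∀ x, (e.symm (e ⟨(L ∘ b) x, x, rfl⟩)).1 = L (b x) := fun x => by
    rw [e.symm_apply_apply]; rfl
  refine ⟨_, fun x => e ⟨(L ∘ b) x, x, rfl⟩, lev, fun k => (e.symm k).1.length,
    fun k i => (e.symm k).1.getD i (Θ x₀), ⟨?_, hlev, ?_, ?_, ?_⟩, ?_, hlev0, ?_⟩
  · rw [IsLocallyConstant.iff_eventually_eq]
    intro x
    filter_upwards [(IsLocallyConstant.iff_eventually_eq _).1 hLb x] with y hy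
    simp only [hy]
  · intro x hx
    simp only [hprf]
    have h1 := hlt x
    have h2 : ret (b x) ≤ lev x + 1 := by
      refine Nat.find_min' _ ⟨by omega, ?_⟩
      rw [Function.iterate_succ_apply', hTb x _ le_rfl]
      simpa using (hlev0 _).1 hx
    simp only [L, List.length_map, List.length_range]
    omega
  · intro x hx
    refine ⟨hsucc x hx, ?_⟩
    simp only [Function.comp_apply, hbsucc x hx]
  · intro x
    simp only [hprf, L, List.length_map, List.length_range]
    exact hlt x
  · intro k
    obtain ⟨⟨_, x, rfl⟩, rfl⟩ := e.surjective k
    exact ⟨x, rfl⟩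
  · intro x
    simp only [hprf]
    have h1 : M.T^[lev x] (b x) = x := by rw [hTb x _ le_rfl, Nat.sub_self]; rfl
    have h2 := hlt x
    rw [List.getD_eq_getElem _ _ (by simpa [L] using h2)]
    simp [L, h1]

end Towers

section Stages
open Filter Topology
variable {M : MinimalCantorSystem} {G : Type} [AddCommGroup G]

/-- `j` exhibits `K⁰(X,T)` as an ordered pure subgroup of `(G, P, u)`. -/
structure IsEmb (M : MinimalCantorSystem) (P : Set G) (u : G) (j : C(M.X, ℤ) →+ G) : Prop where
  ker : ∀ f, j f = 0 ↔ f ∈ (cobMap M).range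
  pos : ∀ f : C(M.X, ℤ), (∀ x, 0 ≤ f x) → j f ∈ P
  one : j 1 = u
  torsionFree : ∀ (g : G) (n : ℕ), 0 < n → n • g ∈ j.range → g ∈ j.range

lemma exists_lift {P : Set G} {u : G} (hG : IsSimpleDimensionGroup G P u)
    {j : C(M.X, ℤ) →+ G} (hj : IsEmb M P u j) {S : Type} [Fintype S] (g : S → G) :
    ∃ (p : ℕ) (f : Fin p → G) (b : S → Fin p → ℤ) (φ : S → C(M.X, ℤ)),
      (∀ l, f l ∈ P) ∧ (∀ s, g s = j (φ s) + ∑ l, b s l • f l) ∧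
      ∀ (c : S → ℤ) (h : C(M.X, ℤ)), ∑ s, c s • g s = j h →
        (∀ l, ∑ s, c s * b s l = 0) ∧ ∑ s, c s • φ s - h ∈ (cobMap M).range := by
  obtain ⟨p, f₀, b, hb, hind⟩ := exists_lift_basis j.range hj.torsionFree g
  choose N hN using fun l => hG.unit_order (-f₀ l)
  have hu : u ∈ j.range := ⟨1, hj.one⟩
  have hf : ∀ n : Fin p → ℤ, ∑ l, n l • (f₀ l + N l • u) =
      ∑ l, n l • f₀ l + ∑ l, n l • N l • u := fun n => by
    simp only [smul_add, sum_add_distrib]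
  have hr : ∀ n : Fin p → ℤ, ∑ l, n l • N l • u ∈ j.range := fun n =>
    AddSubgroup.sum_mem _ fun l _ => AddSubgroup.zsmul_mem _ (AddSubgroup.nsmul_mem _ hu _) _
  have hφ : ∀ s, g s - ∑ l, b s l • (f₀ l + N l • u) ∈ j.range := fun s => by
    rw [hf, ← sub_sub]
    exact AddSubgroup.sub_mem _ (hb s) (hr _)
  choose φ hφ using hφ
  refine ⟨p, fun l => f₀ l + N l • u, b, φ, fun l => ?_, fun s => ?_, fun c h hc => ?_⟩
  · simpa [add_comm] using hN l
  · rw [hφ]; abel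
  have key : ∑ s, c s • g s = ∑ s, c s • j (φ s) +
      ∑ l, (∑ s, c s * b s l) • (f₀ l + N l • u) := by
    simp only [sum_smul]
    rw [sum_comm, ← sum_add_distrib]
    refine sum_congr rfl fun s _ => ?_
    simp only [mul_smul]
    rw [← smul_sum, ← smul_add, hφ s]
    congr 1
    abel
  have hjs : ∑ s, c s • j (φ s) = j (∑ s, c s • φ s) := by
    rw [map_sum]; simp only [map_zsmul]
  have h0 : (fun l => ∑ s, c s * b s l) = 0 := by
    apply hind
    have h1 : ∑ l, (∑ s, c s * b s l) • f₀ l = j h - j (∑ s, c s • φ s) -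
        ∑ l, (∑ s, c s * b s l) • N l • u := by
      rw [← hc, key, hf, hjs]; abel
    rw [h1]
    exact AddSubgroup.sub_mem _ (AddSubgroup.sub_mem _ ⟨h, rfl⟩ ⟨_, rfl⟩) (hr _)
  refine ⟨fun l => congrFun h0 l, (hj.ker _).1 ?_⟩
  have h0' : ∀ l, ∑ s, c s * b s l = 0 := fun l => congrFun h0 l
  rw [map_sub, ← hc, key, hjs]
  simp [h0']

lemma exists_isClopen_base (x₀ : M.X) (R : ℕ) {ι : Type*} [Finite ι] (f : ι → C(M.X, ℤ))
    {V : Set M.X} (hV : IsClopen V) (hx₀ : x₀ ∈ V) :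
    ∃ U : Set M.X, IsClopen U ∧ x₀ ∈ U ∧ U ⊆ V ∧ (∀ k, ∀ x ∈ U, f k x = f k x₀) ∧
      ∀ x ∈ U, ∀ i, 0 < i → i ≤ R → M.T^[i] x ∉ U := by
  have hsep : ∀ i, 0 < i → ∃ B : Set M.X, IsClopen B ∧ x₀ ∈ B ∧ M.T^[i] x₀ ∉ B := by
    intro i hi
    obtain ⟨B, hB, h1, h2⟩ := exists_isClopen_of_totally_separated (iterate_ne M x₀ hi).symm
    exact ⟨B, hB, h1, h2⟩
  choose! B hB hxB hTB using hsep
  refine ⟨V ∩ (⋂ k, {x | f k x = f k x₀}) ∩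
    ⋂ i ∈ Finset.Icc 1 R, (B i ∩ {x | M.T^[i] x ∈ (B i)ᶜ}), ?_, ?_, ?_, ?_, ?_⟩
  · refine (hV.inter (isClopen_iInter_of_finite fun k => ?_)).inter
      (isClopen_biInter_finset fun i hi => ?_)
    · exact (isClopen_discrete {f k x₀}).preimage (f k).continuous
    · have : 0 < i := (Finset.mem_Icc.1 hi).1
      exact (hB i this).inter ((hB i this).compl.preimage (M.T.continuous.iterate i))
  · refine ⟨⟨hx₀, Set.mem_iInter.2 fun k => rfl⟩, Set.mem_iInter₂.2 fun i hi => ?_⟩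
    have : 0 < i := (Finset.mem_Icc.1 hi).1
    exact ⟨hxB i this, hTB i this⟩
  · exact fun x hx => hx.1.1
  · exact fun k x hx => Set.mem_iInter.1 hx.1.2 k
  · intro x hx i hi hiR hx'
    have h1 := Set.mem_iInter₂.1 hx.2 i (Finset.mem_Icc.2 ⟨hi, hiR⟩)
    have h2 := Set.mem_iInter₂.1 hx'.2 i (Finset.mem_Icc.2 ⟨hi, hiR⟩)
    exact h1.2 h2.1

lemma IsKR.walk_back {K : Type} {κ : M.X → K} {lev : M.X → ℕ} {ht : K → ℕ}
    (h : IsKR M κ lev ht) {z : M.X} (hz : lev z = 0) (i : ℕ) :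
    lev (M.T^[i] z) ≤ i ∧ lev (M.T^[i - lev (M.T^[i] z)] z) = 0 ∧
      κ (M.T^[i - lev (M.T^[i] z)] z) = κ (M.T^[i] z) := by
  induction i with
  | zero => simp [hz]
  | succ i ih =>
    by_cases h0 : lev (M.T^[i + 1] z) = 0
    · rw [h0, Nat.sub_zero]; exact ⟨Nat.zero_le _, h0, rfl⟩
    · rw [Function.iterate_succ_apply'] at h0 ⊢
      obtain ⟨h1, h2⟩ := h.step _ h0
      obtain ⟨h3, h4, h5⟩ := ih
      rw [h1, h2, show i + 1 - (lev (M.T^[i] z) + 1) = i - lev (M.T^[i] z) by omega]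
      exact ⟨by omega, h4, h5⟩

/-- A finite approximation of `G`: a Kakutani–Rokhlin structure on `X` together with a splitting
in `G` of the classes of its bottoms into positive elements. -/
structure Stage (M : MinimalCantorSystem) (P : Set G) (j : C(M.X, ℤ) →+ G) where
  q : ℕ
  m : ℕ
  κ : M.X → Fin q
  lev : M.X → ℕ
  ht : Fin q → ℕ
  kr : IsKR M κ lev ht
  base : Fin m → Fin q
  g : Fin m → G
  g_mem : ∀ t, g t ∈ P
  g_ne : ∀ t, g t ≠ 0
  bot_eq : ∀ k, j (kr.bot k) = ∑ t, if base t = k then g t else 0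

namespace Stage
variable {P : Set G} {u : G} {j : C(M.X, ℤ) →+ G}

lemma exists_base (hj : IsEmb M P u j) (s : Stage M P j) (x : M.X) :
    ∃ t, s.base t = s.κ x := by
  by_contra! hcon
  obtain ⟨b, hb, hκ, -⟩ := s.kr.exists_bot x
  refine ind_notMem_range (s.kr.isClopen_bot (s.κ x)) ⟨b, hκ, hb⟩ ((hj.ker _).1 ?_)
  refine (s.bot_eq (s.κ x)).trans (sum_eq_zero fun t _ => if_neg (hcon t))

variable (M) in
/-- The trivial stage, with a single tower of height one. -/
def trivial (hj : IsEmb M P u j) (hu : u ∈ P) (hu0 : u ≠ 0) : Stage M P j where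
  q := 1
  m := 1
  κ := fun _ => 0
  lev := fun _ => 0
  ht := fun _ => 1
  kr := ⟨IsLocallyConstant.const _, IsLocallyConstant.const _, fun _ _ => rfl,
    fun _ h => absurd rfl h, fun _ => Nat.one_pos⟩
  base := fun _ => 0
  g := fun _ => u
  g_mem := fun _ => hu
  g_ne := fun _ => hu0
  bot_eq := fun k => by
    have : k = 0 := Subsingleton.elim _ _
    subst this
    rw [← hj.one]
    simp only [Fin.isValue, ↓reduceIte, univ_unique, sum_const, card_singleton, one_smul]
    congr 1
    ext x
    simp [IsKR.bot_apply]

/-- A stage refining another one, with prescribed words `W` of the new towers in the old ones. -/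
structure Link (x₀ : M.X) (s s' : Stage M P j) (A : Set M.X) (a : G) where
  W : Fin s'.m → ℕ → Fin s.m
  first : Fin s.m
  last : Fin s.m
  lam : Fin s'.q → ℕ → ℕ
  W_zero : ∀ t, W t 0 = first
  W_top : ∀ t, W t (s'.ht (s'.base t) - 1) = last
  W_base : ∀ t x, s'.κ x = s'.base t → s.base (W t (s'.lev x)) = s.κ x
  lev_eq : ∀ x, s.lev x = lam (s'.κ x) (s'.lev x)
  W_succ : ∀ t x, s'.κ x = s'.base t → s.lev (M.T x) ≠ 0 →
    W t (s'.lev (M.T x)) = W t (s'.lev x)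
  lev_zero : ∀ x, s'.lev x = 0 → s.lev x = 0
  lev_base : s'.lev x₀ = 0
  base_first : ∀ x, s'.lev x = 0 → s.κ x = s.base first
  base_last : ∀ x, s'.lev (M.T x) = 0 → s.κ x = s.base last
  g_eq : ∀ k, s.g k = ∑ t, #{i ∈ range (s'.ht (s'.base t)) | lam (s'.base t) i = 0 ∧ W t i = k} •
    s'.g t
  cnt_pos : ∀ k t, 0 < #{i ∈ range (s'.ht (s'.base t)) | lam (s'.base t) i = 0 ∧ W t i = k}
  rel : ∀ c : Fin s.m → ℤ, ∑ k, c k • s.g k = 0 → ∀ t, ∑ k, c k *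
    (#{i ∈ range (s'.ht (s'.base t)) | lam (s'.base t) i = 0 ∧ W t i = k} : ℤ) = 0
  span : ∃ n : Fin s'.m → ℕ, a = ∑ t, n t • s'.g t
  res : ∃ χ : Fin s'.q → ℕ → Prop, ∀ x, x ∈ A ↔ χ (s'.κ x) (s'.lev x)
  exists_tower : ∀ k, ∃ x, s'.κ x = k

end Stage
end Stages

section Step
open Filter Topology
variable {M : MinimalCantorSystem} {G : Type} [AddCommGroup G] {P : Set G} {u : G}
  {j : C(M.X, ℤ) →+ G}

lemma exists_uniform_mul (hG : IsSimpleDimensionGroup G P u) (h0 : (0 : G) ∈ P) {S : Type}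
    [Fintype S] (g : S → G) (hg : ∀ s, g s ∈ P) (hne : ∀ s, g s ≠ 0) :
    ∃ q : ℕ, 0 < q ∧ ∀ s, q • g s - u ∈ P := by
  choose n hn using fun s => hG.simple (g s) (hg s) (hne s) u
  refine ⟨∑ s, n s + 1, by omega, fun s => ?_⟩
  have h1 : n s ≤ ∑ s, n s := single_le_sum (f := n) (fun _ _ => Nat.zero_le _) (mem_univ s)
  obtain ⟨d, hd⟩ := Nat.exists_eq_add_of_le (h1.trans (Nat.le_succ _))
  rw [Nat.succ_eq_add_one] at hd
  rw [hd, add_smul, add_sub_right_comm]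
  exact hG.pos_add _ (hn s) _ (nsmul_mem' hG h0 d (hg s))

lemma isLocallyConstant_coe {S : Type} [Finite S] (φ : S → C(M.X, ℤ)) :
    IsLocallyConstant fun x s => φ s x := by
  rw [IsLocallyConstant.iff_continuous]
  exact continuous_pi fun s => (φ s).continuous

lemma IsKR.sum_bot {K : Type} {κ : M.X → K} {lev : M.X → ℕ} {ht : K → ℕ}
    (h : IsKR M κ lev ht) [DecidableEq K] (k : K) (x : M.X) (n : ℕ) :
    ∑ i ∈ range n, h.bot k (M.T^[i] x) =
      #{i ∈ range n | lev (M.T^[i] x) = 0 ∧ κ (M.T^[i] x) = k} := by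
  rw [card_filter, Nat.cast_sum]
  refine sum_congr rfl fun i _ => ?_
  rw [bot_apply]
  simp [and_comm]

theorem exists_refined_stage (hG : IsSimpleDimensionGroup G P u) (h0 : (0 : G) ∈ P)
    (hj : IsEmb M P u j) (huT : ∃! τ : K0 M →+ ℝ, IsTrace (posCone M) (unitClass M) τ)
    {x₀ : M.X} (s : Stage M P j) (hs : s.lev x₀ = 0) {A : Set M.X} (hA : IsClopen A)
    {a : G} (ha : a ∈ P) (ha0 : a ≠ 0) :
    ∃ (s' : Stage M P j) (w : Fin s'.q → M.X) (lam : Fin s'.q → ℕ → ℕ)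
      (kF : Fin s'.q → ℕ → Fin s.q) (χ : Fin s'.q → ℕ → Prop)
      (N : Option (Fin s.m) → Fin s'.m → ℤ),
      (∀ k, s'.κ (w k) = k ∧ s'.lev (w k) = 0) ∧ s'.lev x₀ = 0 ∧
      (∀ x, s'.lev x = 0 → s.lev x = 0 ∧ s.κ x = s.κ x₀ ∧
        s.κ (M.T.symm x) = s.κ (M.T.symm x₀)) ∧
      (∀ x, s.κ x = kF (s'.κ x) (s'.lev x)) ∧ (∀ x, s.lev x = lam (s'.κ x) (s'.lev x)) ∧
      (∀ x, x ∈ A ↔ χ (s'.κ x) (s'.lev x)) ∧ (∀ σ t, 2 ≤ N σ t) ∧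
      (∀ k, s.g k = ∑ t, N (some k) t • s'.g t) ∧ a = ∑ t, N none t • s'.g t ∧
      (∀ c : Fin s.m → ℤ, ∑ k, c k • s.g k = 0 → ∀ t, ∑ k, c k * N (some k) t = 0) ∧
      ∀ k t, (∑ r, if s.base r = k then N (some r) t else 0) =
        #{i ∈ range (s'.ht (s'.base t)) | lam (s'.base t) i = 0 ∧ kF (s'.base t) i = k} := by
  classical
  let gs : Option (Fin s.m) → G := fun σ => σ.elim a s.g
  have hgs : ∀ σ, gs σ ∈ P := by rintro (_ | k); exacts [ha, s.g_mem k]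
  have hgs0 : ∀ σ, gs σ ≠ 0 := by rintro (_ | k); exacts [ha0, s.g_ne k]
  obtain ⟨p, f, b, φ, hf, hgφ, hrel⟩ := exists_lift hG hj gs
  obtain ⟨q, hq, hqg⟩ := exists_uniform_mul hG h0 gs hgs hgs0
  have hqR : (0 : ℝ) < q := by exact_mod_cast hq
  obtain ⟨τ, hτ⟩ := exists_average huT
  choose R₁ hR₁ using fun σ => hτ (φ σ) (1 / (4 * q)) (by positivity)
  obtain ⟨R, hRR, hRb⟩ : ∃ R : ℕ, (∀ σ, R₁ σ ≤ R) ∧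
      ∀ σ, ∑ l, |(b σ l : ℝ)| + 2 ≤ (R : ℝ) / (2 * q) := by
    let B : Option (Fin s.m) → ℕ := fun σ => ⌈(∑ l, |(b σ l : ℝ)| + 2) * (2 * q)⌉₊
    refine ⟨∑ σ, (R₁ σ + B σ), fun σ => ?_, fun σ => ?_⟩
    · have := single_le_sum (f := fun σ => R₁ σ + B σ) (fun _ _ => Nat.zero_le _) (mem_univ σ)
      omega
    · have := single_le_sum (f := fun σ => R₁ σ + B σ) (fun _ _ => Nat.zero_le _) (mem_univ σ)
      rw [le_div_iff₀ (by positivity)]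
      refine (Nat.le_ceil _).trans ?_
      have h1 : B σ ≤ ∑ σ, (R₁ σ + B σ) := by omega
      exact Nat.cast_le.2 h1
  -- finitely many generators for the relations
  let Λ : Submodule ℤ (Option (Fin s.m) → ℤ) :=
    LinearMap.ker (Fintype.linearCombination ℤ gs)
  have hΛ : ∀ c, c ∈ Λ ↔ ∑ σ, c σ • gs σ = 0 := fun c => by
    rw [LinearMap.mem_ker, Fintype.linearCombination_apply]
  obtain ⟨C, hC⟩ : Λ.FG := IsNoetherian.noetherian Λ
  have hCΛ : ∀ c ∈ C, ∑ σ, c σ • gs σ = j 0 := fun c hc => by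
    rw [map_zero, ← hΛ, ← hC]; exact Submodule.subset_span hc
  have hCob : ∀ c : C, ∃ h, cobMap M h = ∑ σ, c.1 σ • φ σ - 0 := fun c =>
    (hrel c.1 0 (hCΛ c.1 c.2)).2
  choose hc₁ hhc₁ using hCob
  let ck : Fin s.q → Option (Fin s.m) → ℤ := fun k σ =>
    σ.elim 0 fun r => if s.base r = k then 1 else 0
  have hck : ∀ k, ∑ σ, ck k σ • gs σ = j (s.kr.bot k) := fun k => by
    rw [s.bot_eq, Fintype.sum_option]
    simp [ck, gs]
  have hCob₂ : ∀ k, ∃ h, cobMap M h = ∑ σ, ck k σ • φ σ - s.kr.bot k := fun k =>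
    (hrel (ck k) _ (hck k)).2
  choose hc₂ hhc₂ using hCob₂
  -- the base of the new towers
  have hV : IsClopen {x | s.lev x = 0 ∧ s.κ x = s.κ x₀ ∧
      s.κ (M.T.symm x) = s.κ (M.T.symm x₀)} :=
    (s.kr.level.isClopen_fiber 0).inter ((s.kr.tower.isClopen_fiber _).inter
      ((s.kr.tower.isClopen_fiber _).preimage M.T.symm.continuous))
  obtain ⟨U, hU, hxU, hUV, hUf, hUR⟩ := exists_isClopen_base x₀ R (ι := C ⊕ Fin s.q)
    (Sum.elim hc₁ hc₂) hV ⟨hs, rfl, rfl⟩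
  have hAl : IsLocallyConstant fun x => x ∈ A := by
    rw [IsLocallyConstant.iff_eventually_eq]
    intro x
    by_cases hx : x ∈ A
    · filter_upwards [hA.isOpen.mem_nhds hx] with y hy
      simp [hx, hy]
    · filter_upwards [hA.compl.isOpen.mem_nhds hx] with y hy
      simp only [Set.mem_compl_iff] at hy
      simp [hx, hy]
  obtain ⟨q', κ', lev', ht', F, hkr, hsurj, hlev0, hF⟩ := exists_isKR hU ⟨x₀, hxU⟩
    (fun x => (s.κ x, s.lev x, x ∈ A, fun σ => φ σ x))
    (s.kr.tower.prodMk (s.kr.level.prodMk (hAl.prodMk (isLocallyConstant_coe φ))))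
  have hw : ∀ k, ∃ b, κ' b = k ∧ lev' b = 0 := fun k => by
    obtain ⟨x, rfl⟩ := hsurj k
    obtain ⟨b, h1, h2, -⟩ := hkr.exists_bot x
    exact ⟨b, h2, h1⟩
  choose w hw using hw
  have hwF : ∀ k, ∀ i < ht' k, F k i = (s.κ (M.T^[i] (w k)), s.lev (M.T^[i] (w k)),
      (M.T^[i] (w k)) ∈ A, fun σ => φ σ (M.T^[i] (w k))) := fun k i hi => by
    have hi' : i < ht' (κ' (w k)) := by rwa [(hw k).1]
    obtain ⟨h1, h2⟩ := hkr.walk_bot (hw k).2 i hi'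
    rw [hF, h1, h2, (hw k).1]
  have hret : ∀ k, M.T^[ht' k] (w k) ∈ U := fun k => by
    have := hkr.return_bot (hw k).2
    rwa [(hw k).1, hlev0] at this
  have hwU : ∀ k, w k ∈ U := fun k => (hlev0 _).1 (hw k).2
  have hht0 : ∀ k, 0 < ht' k := fun k => by
    have := hkr.ht_pos (w k)
    rwa [(hw k).1] at this
  have hhtR : ∀ k, R ≤ ht' k := fun k => by
    by_contra! hlt
    exact hUR _ (hwU k) _ (hht0 k) hlt.le (hret k)
  let α : Option (Fin s.m) → Fin q' → ℤ := fun σ k => ∑ i ∈ range (ht' k), (F k i).2.2.2 σ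
  have hαφ : ∀ σ k, α σ k = ∑ i ∈ range (ht' k), φ σ (M.T^[i] (w k)) := fun σ k =>
    sum_congr rfl fun i hi => by rw [hwF k i (mem_range.1 hi)]
  have hcobsum : ∀ (c : Option (Fin s.m) → ℤ) (ψ h : C(M.X, ℤ)),
      cobMap M h = ∑ σ, c σ • φ σ - ψ → (∀ x ∈ U, h x = h x₀) →
      ∀ k, ∑ σ, c σ * α σ k = ∑ i ∈ range (ht' k), ψ (M.T^[i] (w k)) := by
    intro c ψ h hh hconst k
    have h1 := sum_cobMap_iterate (g := h) (b := w k) (n := ht' k)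
      (F := fun i => cobMap M h (M.T^[i] (w k))) fun _ _ => rfl
    rw [hconst _ (hret k), hconst _ (hwU k), sub_self] at h1
    rw [← sub_eq_zero, ← h1, hh]
    simp only [hαφ, mul_sum]
    rw [sum_comm, ← sum_sub_distrib]
    refine sum_congr rfl fun i _ => ?_
    rw [ContinuousMap.sub_apply, ContinuousMap.coe_sum, Finset.sum_apply]
    rfl
  have hαΛ : ∀ c ∈ Λ, ∀ k, ∑ σ, c σ * α σ k = 0 := by
    intro c hc k
    rw [← hC] at hc
    induction hc using Submodule.span_induction with
    | mem c hc =>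
      have := hcobsum c 0 (hc₁ ⟨c, hc⟩) (hhc₁ ⟨c, hc⟩) (hUf (Sum.inl ⟨c, hc⟩)) k
      simpa using this
    | zero => simp
    | add c d _ _ h1 h2 => simp only [Pi.add_apply, add_mul, sum_add_distrib, h1, h2, add_zero]
    | smul n c _ h1 =>
      simp only [Pi.smul_apply, smul_eq_mul, mul_assoc, ← mul_sum, h1, mul_zero]
  have hαk : ∀ k k', (∑ r, if s.base r = k then α (some r) k' else 0) =
      #{i ∈ range (ht' k') | (F k' i).2.1 = 0 ∧ (F k' i).1 = k} := by
    intro k k'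
    have h1 := hcobsum (ck k) _ (hc₂ k) (hhc₂ k) (hUf (Sum.inr k)) k'
    rw [s.kr.sum_bot, Fintype.sum_option] at h1
    simp only [ck, Option.elim, zero_mul, zero_add, ite_mul, one_mul] at h1
    rw [h1]
    congr 2
    refine filter_congr fun i hi => ?_
    rw [hwF k' i (mem_range.1 hi)]
  have hjsum : ∀ (ψ : C(M.X, ℤ)) (Fψ : Fin q' → ℕ → ℤ), (∀ x, ψ x = Fψ (κ' x) (lev' x)) →
      j ψ = ∑ k, (∑ i ∈ range (ht' k), Fψ k i) • j (hkr.bot k) := by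
    intro ψ Fψ hψ
    have := (hj.ker _).2 (hkr.sub_sum_bot_mem_range Fψ ψ hψ)
    rw [map_sub, sub_eq_zero, map_sum] at this
    simpa only [map_zsmul] using this
  have hgα : ∀ σ, gs σ = ∑ k, α σ k • j (hkr.bot k) + ∑ l, b σ l • f l := fun σ => by
    rw [hgφ σ, hjsum (φ σ) (fun k i => (F k i).2.2.2 σ) fun x => by rw [← hF]]
  have hu : u = ∑ k, ht' k • j (hkr.bot k) := by
    rw [← hj.one, hjsum 1 (fun _ _ => 1) fun x => rfl]
    simp
  obtain ⟨m', base', g', t, hg', hbase', hft, hge⟩ := exists_refinement hG h0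
    (fun k => j (hkr.bot k)) (fun k => hj.pos _ fun x => by rw [hkr.bot_apply]; split_ifs <;> simp)
    ht' hht0 hu f hf gs α b hgα q hq hqg (fun σ => τ (φ σ))
    (fun σ k => by
      rw [hαφ]
      have := hR₁ σ (ht' k) ((hRR σ).trans (hhtR k)) (w k)
      rw [mul_comm (τ (φ σ))]
      refine this.trans (le_of_eq ?_)
      ring)
    (fun σ k => (hRb σ).trans (by
      have : (R : ℝ) ≤ ht' k := by exact_mod_cast hhtR k
      gcongr))
  have hgN : ∀ σ, gs σ = ∑ r, (α σ (base' r) + ∑ l, b σ l * t r l) • g' r := by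
    intro σ
    rw [hgα]
    simp only [add_smul, sum_add_distrib, sum_smul, hft, smul_sum, mul_smul]
    congr 1
    · simp only [hbase', smul_sum, smul_ite, smul_zero]
      rw [sum_comm]
      exact sum_congr rfl fun r _ => by simp
    · exact sum_comm
  refine ⟨⟨q', m', κ', lev', ht', hkr, base', g', fun r => (hg' r).1, fun r => (hg' r).2,
    hbase'⟩, w, fun k i => (F k i).2.1, fun k i => (F k i).1, fun k i => (F k i).2.2.1,
    fun σ r => α σ (base' r) + ∑ l, b σ l * t r l, hw, (hlev0 _).2 hxU, ?_, ?_, ?_, ?_, hge,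
    fun k => hgN (some k), hgN none, ?_, ?_⟩
  · exact fun x hx => hUV ((hlev0 x).1 hx)
  · exact fun x => by simp only [← hF]
  · exact fun x => by simp only [← hF]
  · exact fun x => by simp only [← hF]
  · intro c hc r
    let c' : Option (Fin s.m) → ℤ := fun σ => σ.elim 0 c
    have hc' : ∑ σ, c' σ • gs σ = 0 := by
      rw [Fintype.sum_option]; simpa [c', gs] using hc
    have h1 := hαΛ c' ((hΛ _).2 hc') (base' r)
    have h2 := (hrel c' 0 (by rw [hc', map_zero])).1
    rw [Fintype.sum_option] at h1
    simp only [c', Option.elim, zero_mul, zero_add, Fintype.sum_option] at h1 h2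
    simp only [mul_add, sum_add_distrib, h1, zero_add, mul_sum, ← mul_assoc]
    rw [sum_comm]
    exact sum_eq_zero fun l _ => by rw [← sum_mul, h2, zero_mul]
  · intro k r
    have h2 := (hrel (ck k) _ (hck k)).1
    simp only [ck, Fintype.sum_option, Option.elim, zero_mul, zero_add, ite_mul, one_mul] at h2
    rw [← hαk k (base' r)]
    have h3 : (∑ r', if s.base r' = k then ∑ l, b (some r') l * t r l else 0) = 0 := by
      have : ∀ r', (if s.base r' = k then ∑ l, b (some r') l * t r l else 0) =
          ∑ l, (if s.base r' = k then b (some r') l else 0) * t r l := fun r' => by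
        split_ifs <;> simp
      simp only [this]
      rw [sum_comm]
      exact sum_eq_zero fun l _ => by rw [← sum_mul, h2, zero_mul]
    rw [← add_zero (∑ r', if s.base r' = k then α (some r') (base' r) else 0), ← h3, ← sum_add_distrib]
    refine sum_congr rfl fun r' _ => ?_
    split_ifs <;> simp

end Step

section Words
variable {M : MinimalCantorSystem} {G : Type} [AddCommGroup G] {P : Set G} {u : G}
  {j : C(M.X, ℤ) →+ G}

theorem exists_link (hG : IsSimpleDimensionGroup G P u) (h0 : (0 : G) ∈ P)
    (hj : IsEmb M P u j) (huT : ∃! τ : K0 M →+ ℝ, IsTrace (posCone M) (unitClass M) τ)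
    {x₀ : M.X} (s : Stage M P j) (hs : s.lev x₀ = 0) {A : Set M.X} (hA : IsClopen A)
    {a : G} (ha : a ∈ P) (ha0 : a ≠ 0) :
    ∃ s' : Stage M P j, Nonempty (Stage.Link x₀ s s' A a) := by
  classical
  obtain ⟨s', w, lam, kF, χ, N, hw, hx₀, hU, hkF, hlam, hχ, hN2, hgN, haN, hrel, hcount⟩ :=
    exists_refined_stage hG h0 hj huT s hs hA ha ha0
  obtain ⟨e, he⟩ := s.exists_base hj x₀
  obtain ⟨e', he'⟩ := s.exists_base hj (M.T.symm x₀)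
  have hwalk : ∀ k, ∀ i < s'.ht k,
      s'.lev (M.T^[i] (w k)) = i ∧ s'.κ (M.T^[i] (w k)) = k := fun k i hi => by
    have := s'.kr.walk_bot (hw k).2 i (by rwa [(hw k).1])
    rwa [(hw k).1] at this
  have hlw : ∀ k, ∀ i < s'.ht k, lam k i = s.lev (M.T^[i] (w k)) := fun k i hi => by
    rw [hlam, (hwalk k i hi).1, (hwalk k i hi).2]
  have hkw : ∀ k, ∀ i < s'.ht k, kF k i = s.κ (M.T^[i] (w k)) := fun k i hi => by
    rw [hkF, (hwalk k i hi).1, (hwalk k i hi).2]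
  have hht : ∀ k, 0 < s'.ht k := fun k => by
    have := s'.kr.ht_pos (w k)
    rwa [(hw k).1] at this
  have hw0 : ∀ k, s.lev (w k) = 0 ∧ s.κ (w k) = s.κ x₀ := fun k =>
    ⟨(hU _ (hw k).2).1, (hU _ (hw k).2).2.1⟩
  have hback : ∀ k, ∀ i < s'.ht k, lam k i ≤ i ∧ lam k (i - lam k i) = 0 ∧
      kF k (i - lam k i) = kF k i := fun k i hi => by
    rw [hlw k i hi, hlw k _ (by omega), hkw k _ (by omega), hkw k i hi]
    exact s.kr.walk_back (hw0 k).1 i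
  have hlast : ∀ k, kF k (s'.ht k - 1) = s.κ (M.T.symm x₀) := fun k => by
    have h1 := hht k
    rw [hkw k _ (by omega)]
    have h2 := (hU _ (s'.kr.return_bot (hw k).2)).2.2
    rw [(hw k).1, show s'.ht k = s'.ht k - 1 + 1 by omega, Function.iterate_succ_apply',
      M.T.symm_apply_apply] at h2
    exact h2
  let Av : Fin s'.q → Finset ℕ := fun k => {i ∈ range (s'.ht k) | lam k i = 0}
  have hmem : ∀ k i, i ∈ Av k ↔ i < s'.ht k ∧ lam k i = 0 := fun k i => by simp [Av]
  have h0A : ∀ k, 0 ∈ Av k := fun k => (hmem _ _).2 ⟨hht k, by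
    rw [hlw k 0 (hht k)]; exact (hw0 k).1⟩
  have hlA : ∀ k, s'.ht k - 1 - lam k (s'.ht k - 1) ∈ Av k := fun k => by
    have h1 := hht k
    exact (hmem _ _).2 ⟨by omega, (hback k _ (by omega)).2.1⟩
  have hM : ∀ t k, (∑ l, if s.base l = k then (N (some l) t).toNat else 0) =
      #{i ∈ Av (s'.base t) | kF (s'.base t) i = k} := fun t k => by
    have h1 := hcount k t
    rw [filter_filter, ← Nat.cast_inj (R := ℤ), ← h1, Nat.cast_sum]
    refine sum_congr rfl fun l _ => ?_
    have := hN2 (some l) t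
    split_ifs
    · omega
    · rfl
  have hM2 : ∀ t l, 2 ≤ (N (some l) t).toNat := fun t l => by
    have := hN2 (some l) t; omega
  have hne : ∀ t, 0 ≠ s'.ht (s'.base t) - 1 - lam (s'.base t) (s'.ht (s'.base t) - 1) := by
    intro t hzero
    set k := s'.base t with hk
    have hkpos := hht k
    obtain ⟨l, hl⟩ := s.exists_base hj (w k)
    have h1 : 2 ≤ #{i ∈ Av k | kF k i = s.κ (w k)} := by
      rw [← hM t]
      refine (hM2 t l).trans (le_trans (le_of_eq (if_pos hl).symm)
        (single_le_sum (f := fun l => if s.base l = s.κ (w k) then (N (some l) t).toNat else 0)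
          (fun _ _ => Nat.zero_le _) (mem_univ l)))
    obtain ⟨i, hi, hi0⟩ := exists_mem_ne h1 0
    obtain ⟨hi1, hi2⟩ := (hmem k i).1 (mem_filter.1 hi).1
    have h2 := (s.kr.walk_back (z := M.T^[i] (w k)) (by rw [← hlw k i hi1]; exact hi2)
      (s'.ht k - 1 - i)).1
    rw [← Function.iterate_add_apply, show s'.ht k - 1 - i + i = s'.ht k - 1 by omega,
      ← hlw k _ (by omega)] at h2
    omega
  have hlab := fun t => exists_labelling (fun l => (N (some l) t).toNat) s.base (Av (s'.base t))
    (kF (s'.base t)) (hM t) (hM2 t) (h0A _) (hlA _) (hne t)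
    (l₁ := e) (l₂ := e') (by rw [he, hkw _ _ (hht _)]; exact (hw0 _).2.symm)
    (by rw [he', (hback _ _ (by have := hht (s'.base t); omega)).2.2, hlast])
  choose v hvb hvc hv0 hvl using hlab
  have hcnt : ∀ k t, #{i ∈ range (s'.ht (s'.base t)) | lam (s'.base t) i = 0 ∧
      v t (i - lam (s'.base t) i) = k} = (N (some k) t).toNat := fun k t => by
    rw [← hvc t k, filter_filter]
    refine congrArg card (filter_congr fun i _ => and_congr_right fun hi => ?_)
    rw [hi, Nat.sub_zero]
  refine ⟨s', ⟨{
    W := fun t i => v t (i - lam (s'.base t) i)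
    first := e
    last := e'
    lam := lam
    W_zero := fun t => by simp only [Nat.zero_sub, hv0]
    W_top := fun t => hvl t
    W_base := fun t x hx => ?_
    lev_eq := hlam
    W_succ := fun t x hx hT => ?_
    lev_zero := fun x hx => (hU x hx).1
    lev_base := hx₀
    base_first := fun x hx => by rw [he, (hU x hx).2.1]
    base_last := fun x hx => by
      rw [he', ← (hU _ hx).2.2, M.T.symm_apply_apply]
    g_eq := fun k => ?_
    cnt_pos := fun k t => ?_
    rel := fun c hc t => ?_
    span := ⟨fun t => (N none t).toNat, ?_⟩
    res := ⟨χ, hχ⟩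
    exists_tower := fun k => ⟨w k, (hw k).1⟩ }⟩⟩
  · have hlt : s'.lev x < s'.ht (s'.base t) := hx ▸ s'.kr.lt x
    obtain ⟨h1, h2, h3⟩ := hback _ _ hlt
    rw [hvb _ _ ((hmem _ _).2 ⟨by omega, h2⟩), h3, hkF x, hx]
  · have hT' : s'.lev (M.T x) ≠ 0 := fun h => hT (hU _ h).1
    obtain ⟨h1, h2⟩ := s'.kr.step x hT'
    have h3 := (s.kr.step x hT).1
    rw [hlam (M.T x), hlam x, h2, hx] at h3
    rw [h3, h1, Nat.add_sub_add_right]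
  · simp only [hcnt]
    rw [hgN k]
    refine sum_congr rfl fun t _ => ?_
    have := hN2 (some k) t
    rw [← natCast_zsmul, Int.toNat_of_nonneg (by omega)]
  · rw [hcnt]
    have := hM2 t k
    omega
  · rw [← hrel c hc t]
    refine sum_congr rfl fun k _ => ?_
    rw [hcnt, Int.toNat_of_nonneg (by have := hN2 (some k) t; omega)]
  · rw [haN]
    refine sum_congr rfl fun t _ => ?_
    have := hN2 none t
    rw [← natCast_zsmul, Int.toNat_of_nonneg (by omega)]

end Words

section Extension
open Filter Topology
variable {M : MinimalCantorSystem} {G : Type} [AddCommGroup G] {P : Set G} {u : G}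
  {j : C(M.X, ℤ) →+ G} {x₀ : M.X}

/-- A sequence of stages, each refining the previous one, which exhausts the clopen subsets of `X`
and the nonzero positive elements of `G`. -/
structure Tower (M : MinimalCantorSystem) (x₀ : M.X) (P : Set G) (u : G)
    (j : C(M.X, ℤ) →+ G) where
  st : ℕ → Stage M P j
  A : ℕ → Set M.X
  a : ℕ → G
  lk : ∀ n, Stage.Link x₀ (st n) (st (n + 1)) (A n) (a n)
  exhaust_clopen : ∀ B : Set M.X, IsClopen B → ∃ n, A n = B
  exhaust_pos : ∀ g ∈ P, g ≠ 0 → ∃ n, a n = g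
  lev_zero : ∀ x, (st 0).lev x = 0
  sum_zero : ∑ t, (st 0).g t = u

lemma exists_tower (hG : IsSimpleDimensionGroup G P u) (h0 : (0 : G) ∈ P)
    (hj : IsEmb M P u j) (huT : ∃! τ : K0 M →+ ℝ, IsTrace (posCone M) (unitClass M) τ)
    (x₀ : M.X) : Nonempty (Tower M x₀ P u j) := by
  have hu0 : u ≠ 0 := by
    intro h
    refine ind_notMem_range (M := M) isClopen_univ Set.univ_nonempty ((hj.ker _).1 ?_)
    rw [← h, ← hj.one]
    congr 1
    ext x
    simp [ind_apply]
  have hcl' : Countable (TopologicalSpace.Clopens M.X) :=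
    TopologicalSpace.Clopens.countable_iff_secondCountable.2 inferInstance
  have hcl : Countable {B : Set M.X // IsClopen B} := by
    have : Function.Injective fun B : {B : Set M.X // IsClopen B} =>
        (⟨B.1, B.2⟩ : TopologicalSpace.Clopens M.X) := fun B C h => by
      simpa [Subtype.ext_iff] using h
    exact this.countable
  obtain ⟨A, hA⟩ := @exists_surjective_nat {B : Set M.X // IsClopen B} ⟨⟨∅, isClopen_empty⟩⟩ hcl
  have hcG := hG.countable
  obtain ⟨a, ha⟩ := @exists_surjective_nat {g : G // g ∈ P ∧ g ≠ 0} ⟨⟨u, hG.unit_pos, hu0⟩⟩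
    inferInstance
  choose nxt hnxt using fun (n : ℕ) (s : {s : Stage M P j // s.lev x₀ = 0}) =>
    exists_link hG h0 hj huT s.1 s.2 (A n).2 (a n).2.1 (a n).2.2
  let lk := fun n s => (hnxt n s).some
  let st : ℕ → {s : Stage M P j // s.lev x₀ = 0} := fun n =>
    Nat.rec ⟨Stage.trivial M hj hG.unit_pos hu0, rfl⟩
      (fun n s => ⟨nxt n s, (lk n s).lev_base⟩) n
  exact ⟨{
    st := fun n => (st n).1
    A := fun n => (A n).1
    a := fun n => (a n).1
    lk := fun n => lk n (st n)
    exhaust_clopen := fun B hB => let ⟨n, hn⟩ := hA ⟨B, hB⟩; ⟨n, by rw [hn]⟩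
    exhaust_pos := fun g hg hg0 => let ⟨n, hn⟩ := ha ⟨g, hg, hg0⟩; ⟨n, by rw [hn]⟩
    lev_zero := fun x => rfl
    sum_zero := by
      change ∑ _t : Fin 1, u = u
      simp }⟩

namespace Tower
variable (D : Tower M x₀ P u j)

lemma lev_base (n : ℕ) : (D.st n).lev x₀ = 0 := by
  cases n with
  | zero => exact D.lev_zero _
  | succ n => exact (D.lk n).lev_base

/-- The almost one-to-one extension of `X` determined by a tower. -/
def Y : Type :=
  {y : M.X × ∀ n, Fin (D.st n).m // ∀ n, (D.st n).base (y.2 n) = (D.st n).κ y.1 ∧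
    y.2 n = (D.lk n).W (y.2 (n + 1)) ((D.st (n + 1)).lev y.1)}

instance : TopologicalSpace D.Y := inferInstanceAs (TopologicalSpace (Subtype _))

variable {D} in
/-- The factor map onto `X`. -/
def Y.pt (y : D.Y) : M.X := y.1.1

variable {D} in
/-- The tower containing a point at a given stage. -/
def Y.idx (y : D.Y) (n : ℕ) : Fin (D.st n).m := y.1.2 n

variable {D} in
/-- The level of a point at a given stage. -/
def Y.lev (y : D.Y) (n : ℕ) : ℕ := (D.st n).lev y.pt

variable {D}

lemma Y.base_idx (y : D.Y) (n : ℕ) : (D.st n).base (y.idx n) = (D.st n).κ y.pt := (y.2 n).1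

lemma Y.idx_eq (y : D.Y) (n : ℕ) : y.idx n = (D.lk n).W (y.idx (n + 1)) (y.lev (n + 1)) :=
  (y.2 n).2

lemma Y.lev_eq (y : D.Y) (n : ℕ) :
    y.lev n = (D.lk n).lam ((D.st (n + 1)).base (y.idx (n + 1))) (y.lev (n + 1)) := by
  rw [base_idx]; exact (D.lk n).lev_eq y.pt

lemma Y.ext {y y' : D.Y} (h : y.pt = y'.pt) (h' : ∀ n, y.idx n = y'.idx n) : y = y' :=
  Subtype.ext (Prod.ext h (funext h'))

lemma Y.continuous_pt : Continuous (Y.pt : D.Y → M.X) :=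
  continuous_fst.comp continuous_subtype_val

lemma Y.continuous_idx (n : ℕ) : Continuous fun y : D.Y => y.idx n :=
  (continuous_apply n).comp (continuous_snd.comp continuous_subtype_val)

lemma Y.isLocallyConstant_idx (n : ℕ) : IsLocallyConstant fun y : D.Y => y.idx n :=
  (IsLocallyConstant.iff_continuous _).2 (Y.continuous_idx n)

lemma Y.isLocallyConstant_lev (n : ℕ) : IsLocallyConstant fun y : D.Y => y.lev n :=
  (D.st n).kr.level.comp_continuous Y.continuous_pt

lemma Y.lev_lt (y : D.Y) (n : ℕ) : y.lev n < (D.st n).ht ((D.st n).base (y.idx n)) := by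
  rw [base_idx]; exact (D.st n).kr.lt y.pt

lemma isClosed_Y : IsClosed {y : M.X × ∀ n, Fin (D.st n).m |
    ∀ n, (D.st n).base (y.2 n) = (D.st n).κ y.1 ∧
      y.2 n = (D.lk n).W (y.2 (n + 1)) ((D.st (n + 1)).lev y.1)} := by
  have hidx : ∀ n, Continuous fun y : M.X × ∀ n, Fin (D.st n).m => y.2 n := fun n =>
    (continuous_apply n).comp continuous_snd
  rw [Set.ofPred_forall]
  refine isClosed_iInter fun n => IsClosed.inter ?_ ?_
  · exact isClosed_eq ((continuous_of_discreteTopology (f := (D.st n).base)).comp (hidx n))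
      ((D.st n).kr.tower.continuous.comp continuous_fst)
  · refine isClosed_eq (hidx n) ?_
    exact (continuous_of_discreteTopology (f := fun p : Fin (D.st (n + 1)).m × ℕ =>
      (D.lk n).W p.1 p.2)).comp
      ((hidx (n + 1)).prodMk ((D.st (n + 1)).kr.level.continuous.comp continuous_fst))

instance : CompactSpace D.Y := isCompact_iff_compactSpace.1 isClosed_Y.isCompact

instance : T2Space D.Y := inferInstanceAs (T2Space (Subtype _))

instance : TotallyDisconnectedSpace D.Y := inferInstanceAs (TotallyDisconnectedSpace (Subtype _))

instance : TopologicalSpace.MetrizableSpace D.Y := by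
  have : SecondCountableTopology (∀ n, Fin (D.st n).m) := inferInstance
  have : SecondCountableTopology (M.X × ∀ n, Fin (D.st n).m) := inferInstance
  have : SecondCountableTopology D.Y :=
    TopologicalSpace.Subtype.secondCountableTopology _
  exact TopologicalSpace.metrizableSpace_of_t3_secondCountable D.Y

lemma Y.lev_zero_of_succ {x : M.X} {n : ℕ} (h : (D.st (n + 1)).lev x = 0) :
    (D.st n).lev x = 0 := (D.lk n).lev_zero x h

/-- The shift on the extension. -/
def Y.shift (y : D.Y) : D.Y :=
  ⟨(M.T y.pt, fun n => (D.lk n).W (y.idx (n + 1)) ((D.st (n + 1)).lev (M.T y.pt))), fun n => by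
    constructor
    · by_cases h : (D.st (n + 1)).lev (M.T y.pt) = 0
      · simp only [h, (D.lk n).W_zero]
        exact ((D.lk n).base_first _ h).symm
      · refine (D.lk n).W_base _ _ ?_
        rw [((D.st (n + 1)).kr.step _ h).2, Y.base_idx]
    · by_cases h : (D.st (n + 1)).lev (M.T y.pt) = 0
      · simp only [h, (D.lk n).W_zero]
      · simp only
        congr 1
        rw [(D.lk (n + 1)).W_succ _ _ _ h]
        · exact y.idx_eq (n + 1)
        · exact (y.base_idx _).symm⟩

@[simp] lemma Y.pt_shift (y : D.Y) : y.shift.pt = M.T y.pt := rfl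

lemma Y.idx_shift (y : D.Y) (n : ℕ) :
    y.shift.idx n = (D.lk n).W (y.idx (n + 1)) ((D.st (n + 1)).lev (M.T y.pt)) := rfl

lemma Y.idx_shift_of_lev_ne (y : D.Y) (n : ℕ) (h : (D.st n).lev (M.T y.pt) ≠ 0) :
    y.shift.idx n = y.idx n := by
  rw [Y.idx_shift, (D.lk n).W_succ _ _ (y.base_idx _).symm h]
  exact (y.idx_eq n).symm

open Classical in
/-- The inverse of the shift on the extension. -/
noncomputable def Y.unshift (y : D.Y) : D.Y :=
  ⟨(M.T.symm y.pt, fun n => if (D.st (n + 1)).lev y.pt = 0 then (D.lk n).last else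
      (D.lk n).W (y.idx (n + 1)) ((D.st (n + 1)).lev (M.T.symm y.pt))), fun n => by
    have key : ∀ n, (D.st n).base (if (D.st (n + 1)).lev y.pt = 0 then (D.lk n).last else
        (D.lk n).W (y.idx (n + 1)) ((D.st (n + 1)).lev (M.T.symm y.pt))) =
          (D.st n).κ (M.T.symm y.pt) := fun n => by
      split_ifs with h
      · exact ((D.lk n).base_last _ (by rwa [M.T.apply_symm_apply])).symm
      · refine (D.lk n).W_base _ _ ?_
        rw [Y.base_idx]
        have := ((D.st (n + 1)).kr.step (M.T.symm y.pt) (by rwa [M.T.apply_symm_apply])).2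
        rw [M.T.apply_symm_apply] at this
        exact this.symm
    refine ⟨key n, ?_⟩
    by_cases h : (D.st (n + 1)).lev y.pt = 0
    · simp only [h, if_true]
      have h1 := (D.st (n + 1)).kr.top (M.T.symm y.pt) (by rwa [M.T.apply_symm_apply])
      rw [← key (n + 1)] at h1
      rw [show (D.st (n + 1)).lev (M.T.symm y.pt) = (D.st (n + 1)).ht _ - 1 from
        Nat.eq_sub_of_add_eq h1, (D.lk n).W_top]
    · have h' : (D.st (n + 2)).lev y.pt ≠ 0 := fun h' => h (Y.lev_zero_of_succ h')
      simp only [h, h', if_false]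
      congr 1
      have h1 := (D.st (n + 2)).kr.step (M.T.symm y.pt) (by rwa [M.T.apply_symm_apply])
      rw [M.T.apply_symm_apply] at h1
      have h2 := (D.lk (n + 1)).W_succ (y.idx (n + 2)) (M.T.symm y.pt)
        (by rw [Y.base_idx, h1.2]) (by rwa [M.T.apply_symm_apply])
      rw [M.T.apply_symm_apply] at h2
      rw [← h2]
      exact y.idx_eq (n + 1)⟩

lemma Y.pt_unshift (y : D.Y) : y.unshift.pt = M.T.symm y.pt := rfl

open Classical in
lemma Y.idx_unshift (y : D.Y) (n : ℕ) :
    y.unshift.idx n = if (D.st (n + 1)).lev y.pt = 0 then (D.lk n).last else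
      (D.lk n).W (y.idx (n + 1)) ((D.st (n + 1)).lev (M.T.symm y.pt)) := rfl

lemma Y.unshift_shift (y : D.Y) : y.shift.unshift = y := by
  have hpt : y.shift.unshift.pt = y.pt := M.T.symm_apply_apply _
  refine Y.ext hpt fun n => ?_
  rw [Y.idx_unshift, Y.pt_shift, M.T.symm_apply_apply]
  split_ifs with h
  · have h1 := (D.st (n + 1)).kr.top y.pt h
    rw [y.idx_eq, Y.lev, Nat.eq_sub_of_add_eq h1, ← y.base_idx, (D.lk n).W_top]
  · rw [Y.idx_shift_of_lev_ne _ _ h]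
    exact (y.idx_eq n).symm

lemma Y.shift_unshift (y : D.Y) : y.unshift.shift = y := by
  have hpt : y.unshift.shift.pt = y.pt := M.T.apply_symm_apply _
  refine Y.ext hpt fun n => ?_
  rw [Y.idx_shift, Y.pt_unshift, M.T.apply_symm_apply, y.idx_eq n]
  by_cases h : (D.st (n + 1)).lev y.pt = 0
  · rw [Y.lev, h, (D.lk n).W_zero, (D.lk n).W_zero]
  · congr 1
    have h1 : y.unshift.shift.idx (n + 1) = y.unshift.idx (n + 1) :=
      Y.idx_shift_of_lev_ne _ _ (by rwa [Y.pt_unshift, M.T.apply_symm_apply])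
    have h' : (D.st (n + 2)).lev y.pt ≠ 0 := fun h' => h (Y.lev_zero_of_succ h')
    have h3 := (D.st (n + 2)).kr.step (M.T.symm y.pt) (by rwa [M.T.apply_symm_apply])
    rw [M.T.apply_symm_apply] at h3
    have h2 := (D.lk (n + 1)).W_succ (y.idx (n + 2)) (M.T.symm y.pt)
      (by rw [Y.base_idx, h3.2]) (by rwa [M.T.apply_symm_apply])
    rw [M.T.apply_symm_apply] at h2
    rw [Y.idx_unshift, if_neg h', ← h2]
    exact (y.idx_eq (n + 1)).symm

lemma Y.continuous_shift : Continuous (Y.shift : D.Y → D.Y) := by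
  refine Continuous.subtype_mk ((M.T.continuous.comp Y.continuous_pt).prodMk
    (continuous_pi fun n => ?_)) _
  exact (continuous_of_discreteTopology (f := fun p : Fin (D.st (n + 1)).m × ℕ =>
    (D.lk n).W p.1 p.2)).comp ((Y.continuous_idx (n + 1)).prodMk
      ((D.st (n + 1)).kr.level.continuous.comp (M.T.continuous.comp Y.continuous_pt)))

variable (D) in
/-- The shift as a homeomorphism. -/
noncomputable def S : D.Y ≃ₜ D.Y :=
  Y.continuous_shift.homeoOfEquivCompactToT2
    (f := ⟨Y.shift, Y.unshift, Y.unshift_shift, Y.shift_unshift⟩)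

end Tower
end Extension

section System
open Filter Topology
variable {M : MinimalCantorSystem} {G : Type} [AddCommGroup G] {P : Set G} {u : G}
  {j : C(M.X, ℤ) →+ G} {x₀ : M.X}
namespace Tower
variable {D : Tower M x₀ P u j}

variable (D) in
/-- The point of the extension over the base point. -/
def y₀ : D.Y :=
  ⟨(x₀, fun n => (D.lk n).first), fun n =>
    ⟨((D.lk n).base_first _ (D.lev_base _)).symm, by
      simp only [D.lev_base, (D.lk n).W_zero]⟩⟩

lemma Y.eq_y₀ {y : D.Y} (h : y.pt = x₀) : y = D.y₀ :=
  Y.ext h fun n => by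
    rw [y.idx_eq, Y.lev, h, D.lev_base, (D.lk n).W_zero]; rfl

instance : Nonempty D.Y := ⟨D.y₀⟩

variable (D) in
/-- Two points are in the same tower at the same level at a given stage. -/
def Same (n : ℕ) (y y' : D.Y) : Prop := y.idx n = y'.idx n ∧ y.lev n = y'.lev n

lemma Same.of_succ {n : ℕ} {y y' : D.Y} (h : D.Same (n + 1) y y') : D.Same n y y' :=
  ⟨by rw [y.idx_eq, y'.idx_eq, h.1, h.2], by rw [y.lev_eq, y'.lev_eq, h.1, h.2]⟩

lemma Same.mono {n k : ℕ} (hk : k ≤ n) {y y' : D.Y} (h : D.Same n y y') : D.Same k y y' := by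
  induction n, hk using Nat.le_induction with
  | base => exact h
  | succ n _ ih => exact ih h.of_succ

lemma eq_of_forall_same {y y' : D.Y} (h : ∀ n, D.Same n y y') : y = y' := by
  refine Y.ext ?_ fun n => (h n).1
  by_contra hne
  obtain ⟨B, hB, h1, h2⟩ := exists_isClopen_of_totally_separated hne
  obtain ⟨n, rfl⟩ := D.exhaust_clopen B hB
  obtain ⟨χ, hχ⟩ := (D.lk n).res
  refine h2 ((hχ _).2 ?_)
  have h3 := (hχ _).1 h1
  rwa [← Y.base_idx, (h (n + 1)).1, Y.base_idx,
    show (D.st (n + 1)).lev y.pt = (D.st (n + 1)).lev y'.pt from (h (n + 1)).2] at h3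

lemma isClosed_same (n : ℕ) : IsClosed {p : D.Y × D.Y | D.Same n p.1 p.2} :=
  IsClosed.inter
    (isClosed_eq ((Y.continuous_idx n).comp continuous_fst)
      ((Y.continuous_idx n).comp continuous_snd))
    (isClosed_eq ((Y.isLocallyConstant_lev n).continuous.comp continuous_fst)
      ((Y.isLocallyConstant_lev n).continuous.comp continuous_snd))

lemma exists_not_same {C : Set (D.Y × D.Y)} (hC : IsClosed C) (hd : ∀ y, (y, y) ∉ C) :
    ∃ n, ∀ p ∈ C, ¬D.Same n p.1 p.2 := by
  obtain ⟨n, hn⟩ := hC.isCompact.elim_directed_cover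
    (fun n => {p : D.Y × D.Y | D.Same n p.1 p.2}ᶜ) (fun n => (isClosed_same n).isOpen_compl)
    (fun p hp => by
      rw [Set.mem_iUnion]
      by_contra! hcon
      refine hd p.1 ?_
      have : p.1 = p.2 := eq_of_forall_same fun n => by simpa using hcon n
      nth_rw 2 [this]
      exact hp)
    (Monotone.directed_le fun k n hkn p hp hn => hp (Same.mono hkn hn))
  exact ⟨n, fun p hp => hn hp⟩

lemma exists_same_subset {V : Set D.Y} (hV : IsOpen V) {y : D.Y} (hy : y ∈ V) :
    ∃ n, ∀ y', D.Same n y' y → y' ∈ V := by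
  obtain ⟨n, hn⟩ := exists_not_same (C := Vᶜ ×ˢ {y}) (hV.isClosed_compl.prod isClosed_singleton)
    (fun z hz => hz.1 (by rw [show z = y from hz.2]; exact hy))
  refine ⟨n, fun y' h => ?_⟩
  by_contra h'
  exact hn (y', y) ⟨h', rfl⟩ h

lemma Y.pt_iterate_shift (y : D.Y) (i : ℕ) : (Y.shift^[i] y).pt = M.T^[i] y.pt := by
  induction i with
  | zero => rfl
  | succ i ih => rw [Function.iterate_succ_apply', Function.iterate_succ_apply', pt_shift, ih]

lemma Y.walk (y : D.Y) (n i : ℕ)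
    (hi : y.lev n + i < (D.st n).ht ((D.st n).base (y.idx n))) :
    (Y.shift^[i] y).idx n = y.idx n ∧ (Y.shift^[i] y).lev n = y.lev n + i := by
  have hlev : ∀ k ≤ i, (Y.shift^[k] y).lev n = y.lev n + k := fun k hk => by
    rw [Y.lev, Y.pt_iterate_shift]
    exact ((D.st n).kr.walk y.pt k (by
      rw [← Y.base_idx]; exact lt_of_le_of_lt (Nat.add_le_add_left hk _) hi)).1
  refine ⟨?_, hlev i le_rfl⟩
  clear hi
  induction i with
  | zero => rfl
  | succ i ih =>
    rw [← ih fun k hk => hlev k (by omega), Function.iterate_succ_apply']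
    refine Y.idx_shift_of_lev_ne _ _ ?_
    have := hlev (i + 1) le_rfl
    rw [Function.iterate_succ_apply', Y.lev, Y.pt_shift] at this
    omega

lemma Y.exists_bot (y : D.Y) (n : ℕ) : ∃ (b : D.Y) (i : ℕ), b.lev n = 0 ∧ Y.shift^[i] b = y := by
  induction hl : y.lev n generalizing y with
  | zero => exact ⟨y, 0, hl, rfl⟩
  | succ l ih =>
    have hT : y.unshift.shift = y := y.shift_unshift
    have h1 := (D.st n).kr.step y.unshift.pt (by
      rw [← Y.pt_shift, hT]; change y.lev n ≠ 0; omega)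
    rw [← Y.pt_shift, hT] at h1
    obtain ⟨b, i, hb, hi⟩ := ih y.unshift (by
      have := h1.1
      change y.lev n = y.unshift.lev n + 1 at this
      omega)
    exact ⟨b, i + 1, hb, by rw [Function.iterate_succ_apply', hi, hT]⟩

lemma Y.exists_walk_bot {b : D.Y} {n : ℕ} (hb : b.lev (n + 1) = 0) (t : Fin (D.st n).m) :
    ∃ l, (Y.shift^[l] b).idx n = t ∧ (Y.shift^[l] b).lev n = 0 := by
  obtain ⟨l, hl⟩ := card_pos.1 ((D.lk n).cnt_pos t (b.idx (n + 1)))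
  simp only [mem_filter, mem_range] at hl
  obtain ⟨h1, h2⟩ := b.walk (n + 1) l (by omega)
  refine ⟨l, ?_, ?_⟩
  · rw [Y.idx_eq, h1, h2, hb, zero_add]; exact hl.2.2
  · rw [Y.lev_eq, h1, h2, hb, zero_add]; exact hl.2.1

lemma exists_orbit_mem (y : D.Y) {V : Set D.Y} (hV : IsOpen V) (hne : V.Nonempty) :
    ∃ (b : D.Y) (i k : ℕ), Y.shift^[i] b = y ∧ Y.shift^[k] b ∈ V := by
  obtain ⟨z, hz⟩ := hne
  obtain ⟨n, hn⟩ := exists_same_subset hV hz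
  obtain ⟨b, i, hb, hi⟩ := y.exists_bot (n + 1)
  obtain ⟨l, h3, h4⟩ := Y.exists_walk_bot hb (z.idx n)
  obtain ⟨h5, h6⟩ := (Y.shift^[l] b).walk n (z.lev n) (by
    rw [h4, h3, zero_add]; exact z.lev_lt n)
  refine ⟨b, i, z.lev n + l, hi, hn _ ⟨?_, ?_⟩⟩
  · rw [Function.iterate_add_apply, h5, h3]
  · rw [Function.iterate_add_apply, h6, h4, zero_add]

lemma S_pow_natCast (n : ℕ) (y : D.Y) : (D.S.toEquiv ^ (n : ℤ)) y = Y.shift^[n] y := by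
  rw [zpow_natCast, ← Equiv.Perm.iterate_eq_pow]; rfl

lemma dense_orbit (y : D.Y) : Dense (Set.range fun n : ℤ => (D.S.toEquiv ^ n) y) := by
  rw [dense_iff_inter_open]
  intro V hV hne
  obtain ⟨b, i, k, rfl, hk⟩ := exists_orbit_mem y hV hne
  refine ⟨_, hk, (k : ℤ) - i, ?_⟩
  simp only
  rw [← S_pow_natCast, ← S_pow_natCast, ← Equiv.Perm.mul_apply, ← zpow_add, sub_add_cancel]

lemma pt_S_pow (n : ℤ) (y : D.Y) : ((D.S.toEquiv ^ n) y).pt = (M.T.toEquiv ^ n) y.pt := by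
  obtain ⟨k, rfl | rfl⟩ := n.eq_nat_or_neg
  · rw [S_pow_natCast, pow_toEquiv_natCast, Y.pt_iterate_shift]
  · have h := Y.pt_iterate_shift ((D.S.toEquiv ^ (-(k : ℤ))) y) k
    rw [← S_pow_natCast, ← Equiv.Perm.mul_apply, ← zpow_add, add_neg_cancel, zpow_zero,
      Equiv.Perm.one_apply, ← pow_toEquiv_natCast] at h
    rw [h, ← Equiv.Perm.mul_apply, ← zpow_add, neg_add_cancel, zpow_zero, Equiv.Perm.one_apply]

lemma Y.surjective_pt : Function.Surjective (Y.pt : D.Y → M.X) := by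
  have hcl : IsClosed (Set.range (Y.pt : D.Y → M.X)) :=
    (isCompact_range Y.continuous_pt).isClosed
  rw [← Set.range_eq_univ, ← hcl.closure_eq]
  refine (Dense.mono ?_ (M.minimal x₀)).closure_eq
  rintro _ ⟨n, rfl⟩
  exact ⟨(D.S.toEquiv ^ n) D.y₀, pt_S_pow n _⟩

lemma continuous_S_pow (n : ℤ) : Continuous fun y : D.Y => (D.S.toEquiv ^ n) y := by
  obtain ⟨k, rfl | rfl⟩ := n.eq_nat_or_neg
  · simp only [S_pow_natCast]; exact Y.continuous_shift.iterate k
  · have : ∀ y : D.Y, (D.S.toEquiv ^ (-(k : ℤ))) y = D.S.symm^[k] y := fun y => by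
      rw [zpow_neg, zpow_natCast, ← inv_pow, ← Equiv.Perm.iterate_eq_pow]; rfl
    simp only [this]; exact D.S.symm.continuous.iterate k

lemma not_isOpen_singleton (y : D.Y) : ¬IsOpen ({y} : Set D.Y) := by
  intro hy
  obtain ⟨_, ⟨n, rfl⟩, hn⟩ := (dense_orbit D.y₀).exists_mem_open hy ⟨y, rfl⟩
  have h1 : IsOpen ({D.y₀} : Set D.Y) := by
    convert hy.preimage (continuous_S_pow n) using 1
    ext z
    simp only [Set.mem_singleton_iff, Set.mem_preimage] at hn ⊢
    rw [← hn, EmbeddingLike.apply_eq_iff_eq]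
  refine M.noIsolated x₀ ?_
  have h2 : ({x₀} : Set M.X) = (Y.pt '' ({D.y₀}ᶜ : Set D.Y))ᶜ := by
    ext x
    simp only [Set.mem_singleton_iff, Set.mem_compl_iff, Set.mem_image, not_exists, not_and]
    constructor
    · rintro rfl z hz hzx
      exact hz (Y.eq_y₀ hzx)
    · intro hx
      obtain ⟨z, rfl⟩ := Y.surjective_pt (D := D) x
      by_contra hne
      refine hx z (fun hz => hne ?_) rfl
      rw [hz]; rfl
  rw [h2]
  exact ((h1.isClosed_compl.isCompact.image Y.continuous_pt).isClosed).isOpen_compl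

variable (D) in
/-- The extension as a minimal Cantor system. -/
noncomputable def sys : MinimalCantorSystem where
  X := D.Y
  noIsolated := not_isOpen_singleton
  T := D.S
  minimal := dense_orbit

end Tower
end System

section Eigenvalues
open Topology
variable {M : MinimalCantorSystem} {G : Type} [AddCommGroup G] {P : Set G} {u : G}
  {j : C(M.X, ℤ) →+ G} {x₀ : M.X}

lemma eigenfunction_pow {lam : ℂ} (hlam : lam ≠ 0) {f : M.X → ℂ}
    (hf : ∀ x, f (M.T x) = lam * f x) (n : ℤ) (x : M.X) :
    f ((M.T.toEquiv ^ n) x) = lam ^ n * f x := by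
  have hnat : ∀ (k : ℕ) (x : M.X), f ((M.T.toEquiv ^ (k : ℤ)) x) = lam ^ k * f x := fun k x => by
    rw [pow_toEquiv_natCast]
    induction k with
    | zero => simp
    | succ k ih => rw [Function.iterate_succ_apply', hf, ih]; ring
  obtain ⟨k, rfl | rfl⟩ := n.eq_nat_or_neg
  · rw [hnat, zpow_natCast]
  · have h := hnat k ((M.T.toEquiv ^ (-(k : ℤ))) x)
    rw [← Equiv.Perm.mul_apply, ← zpow_add, add_neg_cancel, zpow_zero, Equiv.Perm.one_apply] at h
    rw [h, zpow_neg lam, zpow_natCast lam, inv_mul_cancel_left₀ (pow_ne_zero _ hlam)]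

namespace Tower
variable (D : Tower M x₀ P u j)

lemma eigenfunction_fibre {lam : ℂ} (hlam : ‖lam‖ = 1) {f : D.Y → ℂ} (hc : Continuous f)
    (hf : ∀ y, f (D.S y) = lam * f y) {y y' : D.Y} (h : y.pt = y'.pt) : f y = f y' := by
  by_contra hne
  have hd : 0 < ‖f y - f y'‖ := norm_pos_iff.2 (sub_ne_zero.2 hne)
  set d := ‖f y - f y'‖ with hdd
  let V : Set D.Y := f ⁻¹' Metric.ball (f D.y₀) (d / 2)
  have hV : IsOpen V := Metric.isOpen_ball.preimage hc
  have hU : IsOpen (Y.pt '' Vᶜ)ᶜ := (Y.continuous_pt.isClosedMap _ hV.isClosed_compl).isOpen_compl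
  obtain ⟨_, ⟨n, rfl⟩, hn⟩ := (M.minimal y.pt).exists_mem_open hU ⟨x₀, by
    rintro ⟨z, hz, hzx⟩
    exact hz (by rw [Y.eq_y₀ hzx]; exact Metric.mem_ball_self (by positivity))⟩
  have hmem : ∀ z : D.Y, z.pt = y.pt → (D.S.toEquiv ^ n) z ∈ V := fun z hz => by
    by_contra hcon
    exact hn ⟨_, hcon, by rw [pt_S_pow, hz]⟩
  have hlam0 : lam ≠ 0 := by rintro rfl; simp at hlam
  have hpow := eigenfunction_pow (M := D.sys) hlam0 hf n
  have h1 : dist (f ((D.S.toEquiv ^ n) y)) (f ((D.S.toEquiv ^ n) y')) < d := by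
    have := dist_triangle_right (f ((D.S.toEquiv ^ n) y)) (f ((D.S.toEquiv ^ n) y')) (f D.y₀)
    have h2 : dist _ _ < d / 2 := hmem y rfl
    have h3 : dist _ _ < d / 2 := hmem y' h.symm
    linarith
  have h2 : f ((D.S.toEquiv ^ n) y) - f ((D.S.toEquiv ^ n) y') = lam ^ n * (f y - f y') := by
    rw [mul_sub]; exact congrArg₂ _ (hpow y) (hpow y')
  rw [dist_eq_norm, h2, norm_mul, norm_zpow, hlam, one_zpow, one_mul] at h1
  exact lt_irrefl _ h1

/-- The extension has the same continuous eigenvalues as the original system. -/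
lemma eigSet_sys : eigSet D.sys = eigSet M := by
  ext α
  constructor
  · rintro ⟨f, hf0, hf⟩
    have hq : IsQuotientMap (⟨Y.pt, Y.continuous_pt⟩ : C(D.Y, M.X)) :=
      Y.continuous_pt.isClosedMap.isQuotientMap Y.continuous_pt Y.surjective_pt
    have hnorm : ‖Complex.exp (2 * Real.pi * Complex.I * α)‖ = 1 := by
      rw [show (2 * Real.pi * Complex.I * α : ℂ) = ((2 * Real.pi * α : ℝ) : ℂ) * Complex.I by
        push_cast; ring]
      exact Complex.norm_exp_ofReal_mul_I _
    have hfac : Function.FactorsThrough (f : D.Y → ℂ) (⟨Y.pt, Y.continuous_pt⟩ : C(D.Y, M.X)) :=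
      fun y y' h => D.eigenfunction_fibre hnorm f.continuous hf h
    have hlift : ∀ y : D.Y, hq.lift (g := f) hfac y.pt = f y := fun y =>
      DFunLike.congr_fun (hq.lift_comp (g := f) hfac) y
    refine ⟨hq.lift (g := f) hfac, fun h0 => hf0 ?_, fun x => ?_⟩
    · ext y
      exact (hlift y).symm.trans (by rw [h0]; rfl)
    · obtain ⟨y, rfl⟩ := Y.surjective_pt (D := D) x
      rw [← Y.pt_shift, hlift, hlift]
      exact hf y
  · rintro ⟨f, hf0, hf⟩
    refine ⟨f.comp ⟨Y.pt, Y.continuous_pt⟩, fun h0 => hf0 ?_, fun y => hf y.pt⟩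
    ext x
    obtain ⟨y, rfl⟩ := Y.surjective_pt (D := D) x
    exact DFunLike.congr_fun h0 y

end Tower
end Eigenvalues

section DimensionGroup
open Topology
variable {M : MinimalCantorSystem} {G : Type} [AddCommGroup G] {P : Set G} {u : G}
  {j : C(M.X, ℤ) →+ G} {x₀ : M.X}
namespace Tower
variable (D : Tower M x₀ P u j)

/-- The tower of the extension containing a point at a given stage. -/
def tw (n : ℕ) (y : D.sys.X) : Fin (D.st n).m := Y.idx (D := D) y n

/-- The level of a point of the extension at a given stage. -/
def lv (n : ℕ) (y : D.sys.X) : ℕ := Y.lev (D := D) y n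

/-- The height of a tower of the extension. -/
def hgt (n : ℕ) (t : Fin (D.st n).m) : ℕ := (D.st n).ht ((D.st n).base t)

lemma tw_eq (n : ℕ) (y : D.sys.X) :
    D.tw n y = (D.lk n).W (D.tw (n + 1) y) (D.lv (n + 1) y) := Y.idx_eq (D := D) y n

lemma lv_eq (n : ℕ) (y : D.sys.X) : D.lv n y =
    (D.lk n).lam ((D.st (n + 1)).base (D.tw (n + 1) y)) (D.lv (n + 1) y) :=
  Y.lev_eq (D := D) y n

lemma lv_of_le {n k : ℕ} (hk : n ≤ k) {y : D.sys.X} (hy : D.lv k y = 0) : D.lv n y = 0 := by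
  induction k, hk using Nat.le_induction with
  | base => exact hy
  | succ k _ ih => exact ih (Y.lev_zero_of_succ hy)

lemma isKR (n : ℕ) : IsKR D.sys (D.tw n) (D.lv n) (D.hgt n) where
  tower := Y.isLocallyConstant_idx n
  level := Y.isLocallyConstant_lev n
  top y hy := by
    rw [hgt, show (D.st n).base (D.tw n y) = _ from Y.base_idx (D := D) y n]
    exact (D.st n).kr.top (Y.pt (D := D) y) hy
  step y hy := ⟨((D.st n).kr.step (Y.pt (D := D) y) hy).1, Y.idx_shift_of_lev_ne (D := D) y n hy⟩
  lt y := Y.lev_lt (D := D) y n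

lemma exists_bot (n : ℕ) (t : Fin (D.st n).m) : ∃ y, D.tw n y = t ∧ D.lv n y = 0 := by
  obtain ⟨b, -, hb, -⟩ := D.y₀.exists_bot (n + 1)
  obtain ⟨l, hl⟩ := Y.exists_walk_bot hb t
  exact ⟨_, hl⟩

lemma exists_eq_comp (f : C(D.sys.X, ℤ)) :
    ∃ n, ∃ F : Fin (D.st n).m → ℕ → ℤ, (∀ y, f y = F (D.tw n y) (D.lv n y)) ∧
      ((∀ y, 0 ≤ f y) → ∀ t i, 0 ≤ F t i) := by
  classical
  obtain ⟨n, hn⟩ := exists_not_same (D := D) (C := {p | f p.1 ≠ f p.2})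
    (((isClosed_discrete {p : ℤ × ℤ | p.1 ≠ p.2}).preimage
      ((f.continuous.comp continuous_fst).prodMk (f.continuous.comp continuous_snd))))
    (fun y hy => hy rfl)
  refine ⟨n, fun t i => if h : ∃ y, D.tw n y = t ∧ D.lv n y = i then f h.choose else 0,
    fun y => ?_, fun hf t i => ?_⟩
  · have h : ∃ z, D.tw n z = D.tw n y ∧ D.lv n z = D.lv n y := ⟨y, rfl, rfl⟩
    refine Eq.trans ?_ (dif_pos h).symm
    by_contra hne
    exact hn (y, h.choose) hne ⟨h.choose_spec.1.symm, h.choose_spec.2.symm⟩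
  · dsimp only
    split_ifs with h
    · exact hf _
    · exact le_rfl

lemma exists_constant_on_bot (h : C(D.sys.X, ℤ)) :
    ∃ n a, ∀ k ≥ n, ∀ y, D.lv k y = 0 → h y = a := by
  obtain ⟨n, F, hF, -⟩ := D.exists_eq_comp h
  refine ⟨n + 1, F (D.lk n).first 0, fun k hk y hy => ?_⟩
  rw [hF, D.lv_of_le (n.le_succ.trans hk) hy, D.tw_eq, D.lv_of_le hk hy, (D.lk n).W_zero]

/-- The element of `G` with the given coefficients at stage `n`. -/
def val (n : ℕ) (c : Fin (D.st n).m → ℤ) : G := ∑ t, c t • (D.st n).g t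

/-- The function on the extension supported on the bottoms of the towers at stage `n`, with the
given coefficients. -/
noncomputable def bots (n : ℕ) (c : Fin (D.st n).m → ℤ) : C(D.sys.X, ℤ) :=
  ∑ t, c t • (D.isKR n).bot t

lemma bots_apply (n : ℕ) (c : Fin (D.st n).m → ℤ) (y : D.sys.X) :
    D.bots n c y = if D.lv n y = 0 then c (D.tw n y) else 0 := by
  classical
  rw [bots, ContinuousMap.coe_sum, Finset.sum_apply, Finset.sum_eq_single (D.tw n y)]
  · simp [IsKR.bot_apply]
  · intro t _ ht
    simp [IsKR.bot_apply, ht.symm]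
  · simp

lemma val_sub (n : ℕ) (c c' : Fin (D.st n).m → ℤ) :
    D.val n (c - c') = D.val n c - D.val n c' := by
  simp [val, sub_smul]

lemma bots_sub (n : ℕ) (c c' : Fin (D.st n).m → ℤ) :
    D.bots n (c - c') = D.bots n c - D.bots n c' := by
  simp only [bots, Pi.sub_apply, sub_smul, sum_sub_distrib]

/-- The coefficients at stage `n + 1` representing the same element as coefficients at
stage `n`. -/
def next (n : ℕ) (c : Fin (D.st n).m → ℤ) (t : Fin (D.st (n + 1)).m) : ℤ :=
  ∑ k, c k * (#{i ∈ range ((D.st (n + 1)).ht ((D.st (n + 1)).base t)) |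
    (D.lk n).lam ((D.st (n + 1)).base t) i = 0 ∧ (D.lk n).W t i = k} : ℤ)

lemma val_next (n : ℕ) (c : Fin (D.st n).m → ℤ) : D.val (n + 1) (D.next n c) = D.val n c := by
  simp only [val, next, sum_smul]
  rw [sum_comm]
  refine sum_congr rfl fun k _ => ?_
  conv_rhs => rw [(D.lk n).g_eq k, smul_sum]
  refine sum_congr rfl fun t _ => ?_
  rw [mul_smul, natCast_zsmul]

lemma exists_bots_sub_bots_next (n : ℕ) (c : Fin (D.st n).m → ℤ) :
    ∃ h, cobMap D.sys h = D.bots n c - D.bots (n + 1) (D.next n c) ∧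
      ∀ y, D.lv (n + 1) y = 0 → h y = 0 := by
  obtain ⟨h, h1, h2⟩ := (D.isKR (n + 1)).exists_cobMap_eq_sub_sum_bot
    (fun t i => if (D.lk n).lam ((D.st (n + 1)).base t) i = 0 then c ((D.lk n).W t i) else 0)
    (D.bots n c) (fun y => by rw [D.bots_apply, D.lv_eq, D.tw_eq n])
  refine ⟨h, h1.trans ?_, h2⟩
  congr 1
  refine sum_congr rfl fun t _ => ?_
  congr 1
  simp only [next, card_filter, Nat.cast_sum, mul_sum]
  rw [sum_comm]
  refine sum_congr rfl fun i _ => ?_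
  rw [Finset.sum_eq_single ((D.lk n).W t i)]
  · simp
  · intro k _ hk
    simp [hk.symm]
  · simp

lemma exists_stage_eq {n k : ℕ} (hk : n ≤ k) (c : Fin (D.st n).m → ℤ) :
    ∃ c' : Fin (D.st k).m → ℤ, D.val k c' = D.val n c ∧
      ∃ h, cobMap D.sys h = D.bots n c - D.bots k c' ∧ ∀ y, D.lv k y = 0 → h y = 0 := by
  induction k, hk using Nat.le_induction with
  | base => exact ⟨c, rfl, 0, by rw [map_zero, sub_self], fun _ _ => rfl⟩
  | succ k _ ih =>
    obtain ⟨c', h1, h, h2, h3⟩ := ih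
    obtain ⟨h', h4, h5⟩ := D.exists_bots_sub_bots_next k c'
    refine ⟨D.next k c', (D.val_next k c').trans h1, h + h', ?_, fun y hy => ?_⟩
    · rw [map_add, h2, h4, sub_add_sub_cancel]
    · rw [ContinuousMap.add_apply, h5 y hy, h3 y (D.lv_of_le k.le_succ hy), add_zero]

lemma val_eq_zero_iff (n : ℕ) (c : Fin (D.st n).m → ℤ) :
    D.val n c = 0 ↔ D.bots n c ∈ (cobMap D.sys).range := by
  constructor
  · intro h0
    have h1 : D.next n c = 0 := funext fun t => (D.lk n).rel c h0 t
    obtain ⟨h, h2, -⟩ := D.exists_bots_sub_bots_next n c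
    refine ⟨h, h2.trans ?_⟩
    rw [h1]
    simp only [bots, Pi.zero_apply, zero_smul, sum_const_zero, sub_zero]
  · rintro ⟨h, hh⟩
    obtain ⟨n', a, hn'⟩ := D.exists_constant_on_bot h
    obtain ⟨c', h1, h', h2, h3⟩ := D.exists_stage_eq (le_max_left n n') c
    rw [← h1]
    have h4 : cobMap D.sys (h - h') = D.bots (max n n') c' := by
      rw [map_sub, hh, h2, sub_sub_cancel]
    have h5 := hn' _ (le_max_right n n')
    generalize max n n' = k at *
    refine sum_eq_zero fun t _ => ?_
    obtain ⟨b, rfl, hb⟩ := D.exists_bot k t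
    have h6 := sum_cobMap_iterate (M := D.sys) (g := h - h') (b := b) (n := D.hgt k (D.tw k b))
      (F := fun i => if i = 0 then c' (D.tw k b) else 0) (fun i hi => by
        obtain ⟨h7, h8⟩ := (D.isKR k).walk_bot hb i hi
        rw [h4, bots_apply, h7, h8])
    have h9 := (D.isKR k).return_bot hb
    rw [sum_ite_eq', if_pos (mem_range.2 ((D.isKR k).ht_pos b)), ContinuousMap.sub_apply,
      ContinuousMap.sub_apply, h3 _ hb, h3 _ h9, h5 _ hb, h5 _ h9, sub_self] at h6
    rw [h6, zero_smul]

/-- The function `f` represents the element `g`. -/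
def Rep (f : C(D.sys.X, ℤ)) (g : G) : Prop :=
  ∃ n c, f - D.bots n c ∈ (cobMap D.sys).range ∧ D.val n c = g

variable {D}

lemma Rep.sub {f f' : C(D.sys.X, ℤ)} {g g' : G} (h : D.Rep f g) (h' : D.Rep f' g') :
    D.Rep (f - f') (g - g') := by
  obtain ⟨n, c, h1, rfl⟩ := h
  obtain ⟨n', c', h1', rfl⟩ := h'
  obtain ⟨d, h2, k, h3, -⟩ := D.exists_stage_eq (le_max_left n n') c
  obtain ⟨d', h2', k', h3', -⟩ := D.exists_stage_eq (le_max_right n n') c'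
  refine ⟨max n n', d - d', ?_, by rw [val_sub, h2, h2']⟩
  rw [bots_sub]
  convert AddSubgroup.sub_mem _ (AddSubgroup.add_mem _ h1 ⟨k, h3⟩)
    (AddSubgroup.add_mem _ h1' ⟨k', h3'⟩) using 1
  abel

lemma Rep.eq_zero_iff {f : C(D.sys.X, ℤ)} {g : G} (h : D.Rep f g) :
    g = 0 ↔ f ∈ (cobMap D.sys).range := by
  obtain ⟨n, c, h1, rfl⟩ := h
  rw [val_eq_zero_iff, ← AddSubgroup.add_mem_cancel_left _ h1, sub_add_cancel]

lemma Rep.unique {f : C(D.sys.X, ℤ)} {g g' : G} (h : D.Rep f g) (h' : D.Rep f g') : g = g' := by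
  rw [← sub_eq_zero, (h.sub h').eq_zero_iff, sub_self]
  exact AddSubgroup.zero_mem _

variable (D)

lemma exists_rep (f : C(D.sys.X, ℤ)) :
    ∃ n c, f - D.bots n c ∈ (cobMap D.sys).range ∧ ((∀ y, 0 ≤ f y) → ∀ t, 0 ≤ c t) := by
  obtain ⟨n, F, h1, h2⟩ := D.exists_eq_comp f
  exact ⟨n, _, (D.isKR n).sub_sum_bot_mem_range F f h1,
    fun hf t => sum_nonneg fun i _ => h2 hf t i⟩

lemma exists_val_of_mem {p : G} (hp : p ∈ P) : ∃ n c, D.val n c = p ∧ ∀ t, 0 ≤ c t := by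
  by_cases hp0 : p = 0
  · exact ⟨0, 0, by simp [val, hp0], fun _ => le_rfl⟩
  · obtain ⟨n, rfl⟩ := D.exhaust_pos p hp hp0
    obtain ⟨c, hc⟩ := (D.lk n).span
    exact ⟨n + 1, fun t => c t, by simp [val, hc], fun t => Int.natCast_nonneg _⟩

lemma exists_toGroup : ∃ ψ : C(D.sys.X, ℤ) →+ G, ∀ f, D.Rep f (ψ f) := by
  choose n c h _ using D.exists_rep
  have hr : ∀ f, D.Rep f (D.val (n f) (c f)) := fun f => ⟨n f, c f, h f, rfl⟩
  exact ⟨AddMonoidHom.ofMapSub _ fun f f' => (hr (f - f')).unique ((hr f).sub (hr f')), hr⟩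

/-- The dimension group of the extension is `G`. -/
lemma exists_K0_equiv (hG : IsSimpleDimensionGroup G P u) (h0 : (0 : G) ∈ P) :
    ∃ φ : K0 D.sys ≃+ G, ⇑φ '' posCone D.sys = P ∧ φ (unitClass D.sys) = u := by
  obtain ⟨ψ, hψ⟩ := D.exists_toGroup
  have hker : ψ.ker = (cobMap D.sys).range := by
    ext f
    rw [AddMonoidHom.mem_ker, (hψ f).eq_zero_iff]
  have hbots : ∀ n c, ψ (D.bots n c) = D.val n c := fun n c =>
    (hψ _).unique ⟨n, c, by rw [sub_self]; exact AddSubgroup.zero_mem _, rfl⟩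
  have hsurj : Function.Surjective ψ := fun g => by
    obtain ⟨a, ha, b, hb, rfl⟩ := hG.pos_sub g
    obtain ⟨n, c, rfl, -⟩ := D.exists_val_of_mem ha
    obtain ⟨n', c', rfl, -⟩ := D.exists_val_of_mem hb
    exact ⟨D.bots n c - D.bots n' c', by rw [map_sub, hbots, hbots]⟩
  let φ : K0 D.sys ≃+ G := (QuotientAddGroup.quotientAddEquivOfEq hker.symm).trans
    (QuotientAddGroup.quotientKerEquivOfSurjective ψ hsurj)
  have hφ : ∀ f : C(D.sys.X, ℤ), φ (QuotientAddGroup.mk (s := (cobMap D.sys).range) f) = ψ f :=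
    fun f => rfl
  refine ⟨φ, ?_, ?_⟩
  · ext g
    constructor
    · rintro ⟨_, ⟨f, hf, rfl⟩, rfl⟩
      obtain ⟨n, c, h1, h2⟩ := D.exists_rep f
      rw [hφ, (hψ f).unique ⟨n, c, h1, rfl⟩]
      exact sum_mem hG h0 _ _ fun t _ => zsmul_mem' hG h0 (h2 hf t) ((D.st n).g_mem t)
    · intro hg
      obtain ⟨n, c, rfl, hc⟩ := D.exists_val_of_mem hg
      refine ⟨_, ⟨D.bots n c, fun y => ?_, rfl⟩, (hφ _).trans (hbots n c)⟩
      rw [bots_apply]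
      split_ifs
      · exact hc _
      · exact le_rfl
  · refine (hφ 1).trans ?_
    have h1 : (1 : C(D.sys.X, ℤ)) = D.bots 0 fun _ => 1 := by
      ext y
      rw [bots_apply, if_pos (show D.lv 0 y = 0 from D.lev_zero _)]; rfl
    rw [h1, hbots, val]
    simp only [one_smul]
    exact D.sum_zero

end Tower
end DimensionGroup

section Main

/-- The homomorphism from functions to `G` obtained from an order embedding of `K⁰(X,T)`. -/
lemma isEmb_of_equiv {G H : Type} [AddCommGroup G] [AddCommGroup H] {P : Set G} {u : G}
    {Q : Set H} {w : H} {M : MinimalCantorSystem} (φ : K0 M ≃+ H) (hφ : ⇑φ '' posCone M = Q)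
    (hφu : φ (unitClass M) = w) (i : H →+ G) (hinj : Function.Injective i)
    (hord : ∀ h : H, i h ∈ P ↔ h ∈ Q) (hiu : i w = u)
    (htf : ∀ (g : G) (n : ℕ), 0 < n → n • g ∈ i.range → g ∈ i.range) :
    IsEmb M P u (i.comp (φ.toAddMonoidHom.comp (QuotientAddGroup.mk' (cobMap M).range))) where
  ker f := by
    change i (φ (QuotientAddGroup.mk (s := (cobMap M).range) f)) = 0 ↔ _
    rw [map_eq_zero_iff i hinj]
    exact (map_eq_zero_iff φ φ.injective).trans (QuotientAddGroup.eq_zero_iff f)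
  pos f hf := (hord _).2 (hφ ▸ ⟨_, ⟨f, hf, rfl⟩, rfl⟩)
  one := by rw [← hiu, ← hφu]; rfl
  torsionFree := by
    have hr : (i.comp (φ.toAddMonoidHom.comp (QuotientAddGroup.mk' (cobMap M).range))).range =
        i.range := by
      ext g
      constructor
      · rintro ⟨f, rfl⟩
        exact ⟨_, rfl⟩
      · rintro ⟨h, rfl⟩
        obtain ⟨f, hf⟩ := QuotientAddGroup.mk_surjective (s := (cobMap M).range) (φ.symm h)
        refine ⟨f, ?_⟩
        change i (φ (QuotientAddGroup.mk (s := (cobMap M).range) f)) = i h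
        rw [hf]
        exact congrArg i (φ.apply_symm_apply h)
    rw [hr]
    exact htf

lemma existsUnique_trace_of_equiv {H K : Type} [AddCommGroup H] [AddCommGroup K] {Q : Set H}
    {w : H} {R : Set K} {v : K} (φ : K ≃+ H) (hφ : ⇑φ '' R = Q) (hφu : φ v = w)
    (huniq : ∃! τ : H →+ ℝ, IsTrace Q w τ) : ∃! τ : K →+ ℝ, IsTrace R v τ := by
  subst hφ hφu
  obtain ⟨τ, hτ, hu⟩ := huniq
  refine ⟨τ.comp φ.toAddMonoidHom, ⟨fun k hk => hτ.1 _ ⟨k, hk, rfl⟩, hτ.2⟩, fun σ hσ => ?_⟩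
  rw [← hu (σ.comp φ.symm.toAddMonoidHom) ⟨?_, ?_⟩]
  · ext k
    simp
  · rintro _ ⟨k, hk, rfl⟩
    simpa using hσ.1 k hk
  · simpa using hσ.2

end Main

end SimpleDim

/-- If `(G,G⁺,u)` and `(H,H⁺,w)` are simple dimension groups with
distinguished order units, `(H,H⁺,w)` has a unique trace, and there is an order embedding
`i : H → G` with `G/i(H)` torsion free, then `𝓔(H,H⁺,w) ⊆ 𝓔(G,G⁺,u)`. -/
theorem stmt16 {G H : Type} [AddCommGroup G] [AddCommGroup H]
    (P : Set G) (u : G) (Q : Set H) (w : H)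
    (hG : IsSimpleDimensionGroup G P u) (hH : IsSimpleDimensionGroup H Q w)
    (huniq : ∃! τ : H →+ ℝ, IsTrace Q w τ)
    (i : H →+ G) (hinj : Function.Injective i)
    (hord : ∀ h : H, i h ∈ P ↔ h ∈ Q) (hiu : i w = u)
    (htf : ∀ (g : G) (n : ℕ), 0 < n → n • g ∈ i.range → g ∈ i.range)
    (Γ : AddSubgroup ℝ) (hΓ : MemE Q w Γ) :
    MemE P u Γ := by
  obtain ⟨M, ⟨φ, hφ, hφu⟩, hE⟩ := hΓ
  have h0 : (0 : G) ∈ P := by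
    rw [← map_zero i, hord, ← hφ]
    exact ⟨0, ⟨0, fun _ => le_rfl, rfl⟩, map_zero φ⟩
  obtain ⟨D⟩ := SimpleDim.exists_tower hG h0
    (SimpleDim.isEmb_of_equiv φ hφ hφu i hinj hord hiu htf)
    (SimpleDim.existsUnique_trace_of_equiv φ hφ hφu huniq) (Classical.arbitrary M.X)
  exact ⟨D.sys, D.exists_K0_equiv hG h0, by rwa [D.eigSet_sys]⟩
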